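/- arXiv:2012.12100 — 3 statements merged into one kernel-verified Lean document; each statement's English description precedes it below -/
import Mathlib

section
/- Necklace splitting with signed beads (consequence of Hobby–Rice): let g_1, ..., g_n : [0,1] → {-1,0,1} be integrable step functions. Then there exist points 0 = x_0 < x_1 < ... < x_r < x_{r+1} = 1 with r ≤ n such that for every i ∈ [n], the alternating sum Σ_{j=1}^{r+1} (-1)^j ∫_{x_{j-1}}^{x_j} g_i(u) du equals 0. -/
namespace HR
open Finset

/-- alternating indicator -/
def ta : Bool → List ℤ → ZMod 2
  | _, [] => 1
  | s, a :: l => if decide (0 < a) = s then ta (!s) l else 0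

theorem ta_sum (l : List ℤ) : ∀ s, l ≠ [] →
    ∑ i ∈ range l.length, ta s (l.eraseIdx i) = ta s l + ta (!s) l := by
  induction l with
  | nil => intro s h; exact absurd rfl h
  | cons a t ih =>
    intro s _
    rw [List.length_cons, Finset.sum_range_succ']
    simp only [List.eraseIdx_cons_succ, List.eraseIdx_cons_zero]
    by_cases ht : t = []
    · subst ht
      cases s <;> by_cases ha : 0 < a <;> simp [ta, ha]
    · have h1 := ih s ht
      have h2 := ih (!s) ht
      have h22 : ∀ x : ZMod 2, x + x = 0 := by decide
      simp only [ta]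
      rw [Bool.not_not] at h2
      by_cases hs : decide (0 < a) = s
      · have hs' : ¬ (decide (0 < a) = !s) := by rw [hs]; cases s <;> decide
        simp only [if_pos hs, if_neg hs', h2]
        linear_combination h22 (ta s t)
      · have hs' : decide (0 < a) = !s := by
          clear h1 h2; revert hs; generalize decide (0 < a) = b; revert b s; decide
        simp only [if_neg hs, if_pos hs', Bool.not_not, Finset.sum_const_zero]

open Classical in
noncomputable def F (s : Bool) (M : Multiset ℤ) : ZMod 2 :=
  if ∃ l : List ℤ, (l : Multiset ℤ) = M ∧ l.Pairwise (fun a b => |a| ≤ |b|) ∧ ta s l = 1 then 1 else 0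

theorem ta01 (l : List ℤ) (s) : ta s l = 0 ∨ ta s l = 1 := by
  generalize ta s l = x; revert x; decide

theorem F_eq (s : Bool) (l : List ℤ) (hl : l.Pairwise (fun a b => |a| ≤ |b|))
    (nc : ∀ a ∈ l, ∀ b ∈ l, a ≠ -b) : F s l = ta s l := by
  have key : (∃ l' : List ℤ, (l' : Multiset ℤ) = l ∧ l'.Pairwise (fun a b => |a| ≤ |b|) ∧ ta s l' = 1)
      ↔ ta s l = 1 := by
    constructor
    · rintro ⟨l', h1, h2, h3⟩
      have hp : l'.Perm l := Multiset.coe_eq_coe.1 h1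
      have : l' = l := by
        refine List.Perm.eq_of_pairwise ?_ h2 hl hp
        intro a b ha hb h1 h2
        have := abs_eq_abs.1 (le_antisymm h1 h2)
        rcases this with h | h
        · exact h
        · exact absurd h (nc a (hp.mem_iff.1 ha) b hb)
      rwa [← this]
    · intro h; exact ⟨l, rfl, hl, h⟩
  unfold F
  rcases ta01 l s with h | h 
  · rw [if_neg (by rw [key, h]; decide), h]
  · rw [if_pos (key.2 h), h]

theorem ta_neg (l : List ℤ) (h : ∀ a ∈ l, a ≠ 0) : ∀ s, ta (!s) (l.map (fun a => -a)) = ta s l := by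
  induction l with
  | nil => intro s; rfl
  | cons a t ih =>
    intro s
    have ih := ih (fun a ha => h a (by simp [ha]))
    have ha : a ≠ 0 := h a (by simp)
    simp only [List.map_cons, ta]
    rw [ih (!s)]
    rcases lt_or_gt_of_ne ha with h | h
    · have h' : ¬ (0 < a) := by omega
      cases s <;> simp [h, h']
    · have h' : ¬ (a < 0) := by omega
      cases s <;> simp [h, h']

theorem F_neg1 (M : Multiset ℤ) (h : ∀ a ∈ M, a ≠ 0) (s) (h1 : F s M = 1) :
    F (!s) (M.map (fun a => -a)) = 1 := by
  unfold F at h1 ⊢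
  split_ifs at h1 with hh
  · obtain ⟨l, hl, h2, h3⟩ := hh
    rw [if_pos]
    refine ⟨l.map (fun a => -a), by rw [← hl]; rfl, ?_, ?_⟩
    · rw [List.pairwise_map]; simpa using h2
    · rw [ta_neg l (fun a ha => h a (by rw [← hl]; exact ha)), h3]
  · exact absurd h1 (by decide)

theorem F_neg (M : Multiset ℤ) (h : ∀ a ∈ M, a ≠ 0) (s) :
    F (!s) (M.map (fun a => -a)) = F s M := by
  have a1 := F_neg1 M h s
  have a2 := F_neg1 (M.map (fun a => -a)) (by simpa using h) (!s)
  simp only [Multiset.map_map, Function.comp_def, neg_neg, Multiset.map_id', Bool.not_not] at a2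
  revert a1 a2
  generalize F s M = x
  generalize F (!s) (M.map (fun a => -a)) = y
  revert x y; decide

theorem fan (v : ℕ → ℤ) (k : ℕ) (nc : ∀ i ≤ k, ∀ j ≤ k, v i ≠ - v j) :
    ∑ i ∈ range (k+1), F true (((range (k+1)).erase i).val.map v)
      = F true ((range (k+1)).val.map v) + F false ((range (k+1)).val.map v) := by
  set M := (range (k+1)).val.map v with hM
  have e1 : ∑ i ∈ range (k+1), F true (((range (k+1)).erase i).val.map v)
      = (M.map (fun a => F true (M.erase a))).sum := by
    rw [hM, Multiset.map_map, Finset.sum]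
    congr 1
    apply Multiset.map_congr rfl
    intro i hi
    simp only [Function.comp]
    congr 1
    rw [Finset.erase_val]
    conv_rhs => rw [← Multiset.cons_erase hi]
    simp
  rw [e1]
  obtain ⟨l, hlM, hl⟩ : ∃ l : List ℤ, (l : Multiset ℤ) = M ∧ l.Pairwise (fun a b => |a| ≤ |b|) := by
    induction M using Quotient.inductionOn with
    | h l0 =>
    refine ⟨l0.insertionSort (fun a b => |a| ≤ |b|), ?_, ?_⟩
    · exact Multiset.coe_eq_coe.2 (List.perm_insertionSort _ _)
    · have : Std.Total (fun a b : ℤ => |a| ≤ |b|) := ⟨fun a b => le_total _ _⟩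
      have : IsTrans ℤ (fun a b : ℤ => |a| ≤ |b|) := ⟨fun a b c => le_trans⟩
      exact List.pairwise_insertionSort _ _
  have ncl : ∀ a ∈ l, ∀ b ∈ l, a ≠ -b := by
    intro a ha b hb
    have ha' : a ∈ M := by rw [← hlM]; exact ha
    have hb' : b ∈ M := by rw [← hlM]; exact hb
    simp only [hM, Multiset.mem_map, Finset.mem_val, Finset.mem_range] at ha' hb'
    obtain ⟨i, hi, rfl⟩ := ha'
    obtain ⟨j, hj, rfl⟩ := hb'
    exact nc i (by omega) j (by omega)
  have hne : l ≠ [] := by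
    rintro rfl
    have := congrArg Multiset.card hlM
    simp [hM] at this
  rw [← hlM, F_eq true l hl ncl, F_eq false l hl ncl]
  have := ta_sum l true hne
  simp only [Bool.not_true] at this
  rw [← this, Multiset.map_coe, Multiset.sum_coe, ← Fin.sum_univ_getElem, Finset.sum_range]
  rw [← Equiv.sum_comp (finCongr (List.length_map (f := fun a => F true ((l : Multiset ℤ).erase a)) (as := l)).symm)]
  apply Finset.sum_congr rfl
  intro i _
  simp only [finCongr_apply, Fin.val_cast, List.getElem_map]
  have : (l : Multiset ℤ).erase l[(i:ℕ)] = (l.eraseIdx i : List ℤ) := by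
    have h1 : (l : Multiset ℤ) = l[(i:ℕ)] ::ₘ (l.eraseIdx i : List ℤ) := by
      rw [Multiset.cons_coe]
      exact Multiset.coe_eq_coe.2 (List.getElem_cons_eraseIdx_perm i.2).symm
    rw [h1, Multiset.erase_cons_head]
  rw [this]
  have sub : (l.eraseIdx i).Sublist l := List.eraseIdx_sublist ..
  exact F_eq _ _ (hl.sublist sub) (fun a ha b hb => ncl a (sub.subset ha) b (sub.subset hb))

end HR
namespace HR
open Finset

/-- vertex number `i` of the flag given by a permutation and signs -/
def vx {N : ℕ} (w : Equiv.Perm (Fin N) × (Fin N → ℤˣ)) (i : ℕ) : Fin N → ℤ :=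
  fun j => if ((w.1.symm j : Fin N) : ℕ) ≤ i then ((w.2 j : ℤˣ) : ℤ) else 0

def II (N k : ℕ) : Finset (Equiv.Perm (Fin N) × (Fin N → ℤˣ)) :=
  univ.filter (fun w => (∀ j : Fin N, k ≤ (j:ℕ) → w.1 j = j) ∧ ∀ j : Fin N, k ≤ (j:ℕ) → w.2 j = 1)

noncomputable def AA {N : ℕ} (lab : (Fin N → ℤ) → ℤ) (k : ℕ) : ZMod 2 :=
  ∑ w ∈ II N k, F true ((range k).val.map (fun i => lab (vx w i)))

structure TL {N : ℕ} (lab : (Fin N → ℤ) → ℤ) : Prop where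
  anti : ∀ X, (∀ j, X j = -1 ∨ X j = 0 ∨ X j = 1) → X ≠ 0 → lab (-X) = - lab X
  nc : ∀ X Y, (∀ j, X j = -1 ∨ X j = 0 ∨ X j = 1) → (∀ j, Y j = -1 ∨ Y j = 0 ∨ Y j = 1) →
    X ≠ 0 → Y ≠ 0 → (∀ j, X j ≠ 0 → Y j = X j) → lab X ≠ - lab Y

theorem vx_val {N : ℕ} (w : Equiv.Perm (Fin N) × (Fin N → ℤˣ)) (i : ℕ) (j) :
    vx w i j = -1 ∨ vx w i j = 0 ∨ vx w i j = 1 := by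
  unfold vx
  rcases Int.units_eq_one_or (w.2 j) with h | h <;> rw [h] <;> split_ifs <;> simp

theorem vx_ne {N : ℕ} (hN : 0 < N) (w : Equiv.Perm (Fin N) × (Fin N → ℤˣ)) (i : ℕ) : vx w i ≠ 0 := by
  intro h
  have := congrFun h (w.1 ⟨0, hN⟩)
  simp [vx] at this

theorem vx_le {N : ℕ} (w : Equiv.Perm (Fin N) × (Fin N → ℤˣ)) {i i' : ℕ} (h : i ≤ i') (j) (hj : vx w i j ≠ 0) :
    vx w i' j = vx w i j := by
  unfold vx at *
  split_ifs at * <;> first | rfl | omega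

theorem TL.ncv {N : ℕ} (hN : 0 < N) {lab : (Fin N → ℤ) → ℤ} (hl : TL lab)
    (w : Equiv.Perm (Fin N) × (Fin N → ℤˣ)) (i j : ℕ) : lab (vx w i) ≠ - lab (vx w j) := by
  rcases le_total i j with h | h
  · exact hl.nc _ _ (vx_val w i) (vx_val w j) (vx_ne hN w i) (vx_ne hN w j) (vx_le w h)
  · have := hl.nc _ _ (vx_val w j) (vx_val w i) (vx_ne hN w j) (vx_ne hN w i) (vx_le w h)
    omega

theorem AA_zero {N : ℕ} (lab : (Fin N → ℤ) → ℤ) : AA lab 0 = 1 := by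
  have : II N 0 = {(1, fun _ => 1)} := by
    ext w
    simp only [II, mem_filter, mem_univ, true_and, mem_singleton, Nat.zero_le, forall_true_left]
    constructor
    · rintro ⟨h1, h2⟩
      exact Prod.ext (Equiv.ext h1) (funext h2)
    · rintro rfl; simp
  unfold AA
  rw [this, sum_singleton]
  have := F_eq true [] List.Pairwise.nil (by simp)
  simpa [ta] using this

theorem symm_fix {N k : ℕ} {w : Equiv.Perm (Fin N) × (Fin N → ℤˣ)} (h : ∀ j : Fin N, k ≤ (j:ℕ) → w.1 j = j)
    (j : Fin N) (hj : k ≤ (j:ℕ)) : w.1.symm j = j := by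
  rw [Equiv.symm_apply_eq, h j hj]

/-- global flip on the first k coordinates -/
def flip {N : ℕ} (k : ℕ) (w : Equiv.Perm (Fin N) × (Fin N → ℤˣ)) : Equiv.Perm (Fin N) × (Fin N → ℤˣ) :=
  (w.1, fun j => if (j:ℕ) < k then - w.2 j else w.2 j)

theorem flip_flip {N : ℕ} (k : ℕ) (w : Equiv.Perm (Fin N) × (Fin N → ℤˣ)) : flip k (flip k w) = w := by
  refine Prod.ext rfl (funext fun j => ?_)
  simp only [flip]; split_ifs <;> simp

theorem flip_mem {N : ℕ} {k : ℕ} {w : Equiv.Perm (Fin N) × (Fin N → ℤˣ)} (h : w ∈ II N k) : flip k w ∈ II N k := by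
  simp only [II, mem_filter, mem_univ, true_and, flip] at *
  refine ⟨h.1, fun j hj => ?_⟩
  rw [if_neg (by omega)]; exact h.2 j hj

theorem vx_flip {N : ℕ} {k i : ℕ} (hi : i < k) {w : Equiv.Perm (Fin N) × (Fin N → ℤˣ)} (h : w ∈ II N k) :
    vx (flip k w) i = - vx w i := by
  simp only [II, mem_filter, mem_univ, true_and] at h
  funext j
  simp only [vx, flip, Pi.neg_apply]
  by_cases hj : (j:ℕ) < k
  · simp only [if_pos hj]; split_ifs <;> simp
  · have h5 := symm_fix h.1 j (by omega)
    have h6 : ¬ ((w.1.symm j : Fin N) : ℕ) ≤ i := by rw [h5]; omega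
    simp [h6]

theorem F_flip {N : ℕ} (hN : 0 < N) {lab : (Fin N → ℤ) → ℤ} (hl : TL lab) {k : ℕ}
    {w : Equiv.Perm (Fin N) × (Fin N → ℤˣ)} (h : w ∈ II N k) :
    F true ((range k).val.map (fun i => lab (vx (flip k w) i))) = F false ((range k).val.map (fun i => lab (vx w i))) := by
  rw [← F_neg ((range k).val.map (fun i => lab (vx w i))) _ false, Multiset.map_map]
  · simp only [Bool.not_false]
    congr 1
    apply Multiset.map_congr rfl
    intro i hi
    have hi : i < k := by simpa using hi
    simp only [Function.comp]
    rw [vx_flip hi h, hl.anti _ (vx_val w i) (vx_ne hN w i)]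
  · intro a ha
    obtain ⟨i, _, rfl⟩ := Multiset.mem_map.1 ha
    have := hl.ncv hN w i i
    omega

theorem AA_succ {N : ℕ} {lab : (Fin N → ℤ) → ℤ} (hl : TL lab) (k : ℕ) (hk : k < N) :
    AA lab (k+1) = AA lab k := by
  have hN : 0 < N := by omega
  have h22 : ∀ x : ZMod 2, x + x = 0 := by decide
  let K : Fin N := ⟨k, hk⟩
  let H := (II N (k+1)).filter (fun w => w.2 K = 1)
  have e1 : AA lab (k+1) = ∑ w ∈ H, (F true ((range (k+1)).val.map (fun i => lab (vx w i)))
      + F false ((range (k+1)).val.map (fun i => lab (vx w i)))) := by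
    unfold AA
    rw [← Finset.sum_filter_add_sum_filter_not _ (fun w => w.2 K = 1), sum_add_distrib]
    congr 1
    refine Finset.sum_bij' (fun w _ => flip (k+1) w) (fun w _ => flip (k+1) w) ?_ ?_ ?_ ?_ ?_
    · intro w hw
      rw [mem_filter] at hw
      refine mem_filter.2 ⟨flip_mem hw.1, ?_⟩
      have := (Int.units_eq_one_or (w.2 K)).resolve_left hw.2
      simp [flip, K] at this ⊢
      rw [this]; simp
    · intro w hw
      rw [mem_filter] at hw ⊢
      refine ⟨flip_mem hw.1, ?_⟩
      have := hw.2
      simp [flip, K] at this ⊢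
      rw [this]; decide
    · intro w _; exact flip_flip _ _
    · intro w _; exact flip_flip _ _
    · intro w hw
      rw [← F_flip hN hl (flip_mem (mem_filter.1 hw).1), flip_flip]
  rw [e1]
  have e2 : ∀ w ∈ H, (F true ((range (k+1)).val.map (fun i => lab (vx w i)))
      + F false ((range (k+1)).val.map (fun i => lab (vx w i)))) =
      ∑ i ∈ range (k+1), F true (((range (k+1)).erase i).val.map (fun i => lab (vx w i))) :=
    fun w _ => (fan (fun i => lab (vx w i)) k (fun i _ j _ => hl.ncv hN w i j)).symm
  rw [sum_congr rfl e2, sum_comm, sum_range_succ]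
  have e3 : ∑ i ∈ range k, ∑ w ∈ H, F true (((range (k+1)).erase i).val.map (fun i => lab (vx w i))) = 0 := by
    apply sum_eq_zero
    intro i hi
    have hi : i < k := by simpa using hi
    let a : Fin N := ⟨i, by omega⟩
    let b : Fin N := ⟨i+1, by omega⟩
    have hab : a ≠ b := by intro h; simp [a, b] at h
    refine Finset.sum_involution (fun w _ => (w.1 * Equiv.swap a b, w.2)) ?_ ?_ ?_ ?_
    · intro w hw
      have : ∀ j ∈ ((range (k+1)).erase i).val, lab (vx (w.1 * Equiv.swap a b, w.2) j) = lab (vx w j) := by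
        intro j hj
        have hj : j ≠ i := by
          rw [Finset.mem_val] at hj; exact (mem_erase.1 hj).1
        congr 1
        funext c
        simp only [vx]
        have : (w.1 * Equiv.swap a b).symm c = Equiv.swap a b (w.1.symm c) := by
          rw [Equiv.symm_apply_eq]; simp
        rw [this]
        generalize w.1.symm c = d
        have : ((Equiv.swap a b d : Fin N) : ℕ) ≤ j ↔ (d : ℕ) ≤ j := by
          rw [Equiv.swap_apply_def]
          split_ifs with h1 h2
          · subst h1; simp [a, b]; omega
          · subst h2; simp [a, b]; omega
          · rfl
        simp only [this]
      rw [Multiset.map_congr rfl this]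
      exact h22 _
    · intro w hw _ h
      have := congrArg Prod.fst h
      simp only [mul_eq_left] at this
      exact hab (Equiv.swap_eq_one_iff.1 this)
    · intro w hw
      simp only [H, II, mem_filter, mem_univ, true_and] at hw ⊢
      refine ⟨⟨fun j hj => ?_, hw.1.2⟩, hw.2⟩
      rw [Equiv.Perm.mul_apply, Equiv.swap_apply_of_ne_of_ne, hw.1.1 j hj]
      · rintro rfl; simp [a] at hj; omega
      · rintro rfl; simp [b] at hj; omega
    · intro w hw
      simp [mul_assoc]
  rw [e3, zero_add, range_add_one, erase_insert (by simp),
    ← Finset.sum_filter_add_sum_filter_not H (fun w => w.1 K = K)]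
  have e4 : ∑ w ∈ H.filter (fun w => ¬ w.1 K = K), F true ((range k).val.map (fun i => lab (vx w i))) = 0 := by
    refine Finset.sum_involution (fun w _ => (w.1, Function.update w.2 (w.1 K) (- w.2 (w.1 K)))) ?_ ?_ ?_ ?_
    · intro w hw
      have : ∀ j ∈ (range k).val, lab (vx (w.1, Function.update w.2 (w.1 K) (- w.2 (w.1 K))) j) = lab (vx w j) := by
        intro j hj
        have hj : j < k := by simpa using hj
        congr 1
        funext c
        simp only [vx]
        by_cases hc : c = w.1 K
        · subst hc; simp [K]; omega
        · rw [Function.update_of_ne hc]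
      rw [Multiset.map_congr rfl this]
      exact h22 _
    · intro w hw _ h
      have := congrFun (congrArg Prod.snd h) (w.1 K)
      simp only [Function.update_self] at this
      revert this
      generalize w.2 (w.1 K) = u
      revert u; decide
    · intro w hw
      simp only [H, II, mem_filter, mem_univ, true_and] at hw ⊢
      refine ⟨⟨⟨hw.1.1.1, fun j hj => ?_⟩, ?_⟩, hw.2⟩
      · rw [Function.update_of_ne, hw.1.1.2 j hj]
        intro h
        have h3 := hw.1.1.1 j hj
        have : j = K := w.1.injective (h3.trans h)
        rw [this] at hj; simp [K] at hj
      · rw [Function.update_of_ne (Ne.symm hw.2), hw.1.2]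
    · intro w hw
      simp
  rw [e4, add_zero]
  unfold AA
  apply sum_congr _ (fun _ _ => rfl)
  ext w
  simp only [H, II, mem_filter, mem_univ, true_and]
  constructor
  · rintro ⟨⟨⟨h1, h2⟩, h3⟩, h4⟩
    constructor
    · intro j hj
      rcases hj.lt_or_eq with h | h
      · exact h1 j h
      · have : j = K := Fin.ext h.symm
        rw [this, h4]
    · intro j hj
      rcases hj.lt_or_eq with h | h
      · exact h2 j h
      · have : j = K := Fin.ext h.symm
        rw [this, h3]
  · rintro ⟨h1, h2⟩
    exact ⟨⟨⟨fun j hj => h1 j (by omega), fun j hj => h2 j (by omega)⟩, h2 K (by simp [K])⟩, h1 K (by simp [K])⟩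

theorem ta_strict (l : List ℤ) : ∀ s, l.Pairwise (fun a b => |a| ≤ |b|) → (∀ a ∈ l, ∀ b ∈ l, a ≠ -b) →
    ta s l = 1 → l.Pairwise (fun a b => |a| < |b|) := by
  induction l with
  | nil => intros; exact List.Pairwise.nil
  | cons a t ih =>
    intro s h1 h2 h3
    rw [List.pairwise_cons] at h1
    simp only [ta] at h3
    by_cases hs : decide (0 < a) = s
    swap
    · rw [if_neg hs] at h3; exact absurd h3 (by decide)
    rw [if_pos hs] at h3
    have ih := ih (!s) h1.2 (fun a ha b hb => h2 a (by simp [ha]) b (by simp [hb])) h3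
    refine List.pairwise_cons.2 ⟨?_, ih⟩
    cases t with
    | nil => simp
    | cons b u =>
      simp only [ta] at h3
      by_cases hs' : decide (0 < b) = !s
      swap
      · rw [if_neg hs'] at h3; exact absurd h3 (by decide)
      have hab : |a| < |b| := by
        refine lt_of_le_of_ne (h1.1 b (by simp)) ?_
        intro h
        rcases abs_eq_abs.1 h with h | h
        · rw [h, hs'] at hs; revert hs; cases s <;> decide
        · exact h2 a (by simp) b (by simp) h
      intro c hc
      rcases List.mem_cons.1 hc with rfl | hc
      · exact hab
      · exact hab.trans ((List.pairwise_cons.1 ih).1 c hc)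

theorem tucker {N m : ℕ} {lab : (Fin N → ℤ) → ℤ} (hl : TL lab)
    (hm : ∀ X, (∀ j, X j = -1 ∨ X j = 0 ∨ X j = 1) → X ≠ 0 → |lab X| ≤ m) : N ≤ m := by
  rcases Nat.eq_zero_or_pos N with h0 | hN
  · omega
  have h : ∀ k ≤ N, AA lab k = 1 := by
    intro k
    induction k with
    | zero => intro _; exact AA_zero lab
    | succ k ih => intro hk; rw [AA_succ hl k hk, ih (by omega)]
  have hA := h N le_rfl
  obtain ⟨w, _, hw⟩ := Finset.exists_ne_zero_of_sum_ne_zero (s := II N N)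
    (f := fun w => F true ((range N).val.map (fun i => lab (vx w i)))) (by
      change AA lab N ≠ 0; rw [hA]; decide)
  unfold F at hw
  split_ifs at hw with hh
  · obtain ⟨l, h1, h2, h3⟩ := hh
    have hmem : ∀ a ∈ l, ∃ i, lab (vx w i) = a := by
      intro a ha
      have : a ∈ (l : Multiset ℤ) := ha
      rw [h1] at this
      obtain ⟨i, _, h⟩ := Multiset.mem_map.1 this
      exact ⟨i, h⟩
    have nc : ∀ a ∈ l, ∀ b ∈ l, a ≠ -b := by
      intro a ha b hb
      obtain ⟨i, rfl⟩ := hmem a ha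
      obtain ⟨j, rfl⟩ := hmem b hb
      exact hl.ncv hN w i j
    have h4 := ta_strict l true h2 nc h3
    have hlen : l.length = N := by
      have := congrArg Multiset.card h1
      simpa using this
    have hnd : (l.map Int.natAbs).Nodup := by
      rw [List.Nodup, List.pairwise_map]
      refine h4.imp ?_
      intro a b hab; rw [Int.abs_eq_natAbs, Int.abs_eq_natAbs] at hab; omega
    have hsub : (l.map Int.natAbs).toFinset ⊆ Finset.Icc 1 m := by
      intro c hc
      simp only [List.mem_toFinset, List.mem_map] at hc
      obtain ⟨a, ha, rfl⟩ := hc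
      have := nc a ha a ha
      obtain ⟨i, rfl⟩ := hmem a ha
      have := hm _ (vx_val w i) (vx_ne hN w i)
      rw [Int.abs_eq_natAbs] at this
      simp only [Finset.mem_Icc]; omega
    have := Finset.card_le_card hsub
    rw [List.toFinset_card_of_nodup hnd] at this
    simp [hlen] at this
    exact this
  · exact absurd rfl hw
end HR
namespace HR
open Finset

/-- mismatches -/
def dd : ℤ → List ℤ → ℕ
  | _, [] => 0
  | s, a :: l => if a = s then dd s l else dd (-s) l + 1

def SV (l : List ℤ) : Prop := ∀ a ∈ l, a = -1 ∨ a = 0 ∨ a = 1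

def Le : List ℤ → List ℤ → Prop := List.Forall₂ (fun a b => a ≠ 0 → b = a)

theorem dd_close (l : List ℤ) : ∀ s, dd s l ≤ dd (-s) l + 1 := by
  induction l with
  | nil => intro s; simp [dd]
  | cons a t ih =>
    intro s
    have h1 := ih s
    have h2 := ih (-s)
    simp only [dd, neg_neg] at *
    split_ifs <;> omega

theorem dd_mono {X Y : List ℤ} (h : Le X Y) : ∀ s, s ≠ 0 → dd s Y ≤ dd s X := by
  induction h with
  | nil => intro s _; simp
  | @cons a b l1 l2 hab _ ih =>
    intro s hs
    have h1 := ih s hs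
    have h2 := ih (-s) (by simpa using hs)
    have h3 := dd_close l2 s
    simp only [dd]
    split_ifs with h5 h6 h6
    · exact h1
    · omega
    · exfalso; apply h5; rw [hab (by rw [h6]; exact hs), h6]
    · omega

theorem dd_neg (l : List ℤ) : ∀ s, dd (-s) (l.map (fun a => -a)) = dd s l := by
  induction l with
  | nil => intro s; rfl
  | cons a t ih =>
    intro s
    simp only [List.map_cons, dd, neg_inj, ih]

theorem dd_zero (l : List ℤ) : ∀ s, s ≠ 0 → l.count 0 ≤ dd s l := by
  induction l with
  | nil => intro s _; simp
  | cons a t ih =>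
    intro s hs
    have h1 := ih s hs
    have h2 := ih (-s) (by simpa using hs)
    simp only [dd, List.count_cons]
    split_ifs with h3 h4
    · simp_all
    · omega
    · omega
    · omega

theorem dd_len (l : List ℤ) : ∀ s, dd s l ≤ l.length := by
  induction l with
  | nil => intro s; simp [dd]
  | cons a t ih =>
    intro s
    have h1 := ih s
    have h2 := ih (-s)
    simp only [dd, List.length_cons]
    split_ifs <;> omega

theorem dd_ne (l : List ℤ) (hv : SV l) (h : ∃ a ∈ l, a ≠ 0) : dd 1 l ≠ dd (-1) l := by
  induction l with
  | nil => simp at h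
  | cons a t ih =>
    simp only [dd]
    rcases hv a (by simp) with h1 | h1 | h1
    · subst h1; simp
    · subst h1
      have := ih (fun a ha => hv a (by simp [ha])) (by simpa using h)
      simp; omega
    · subst h1; simp

/-- weighted sum of a sign list from offset k -/
noncomputable def S (N : ℕ) (G : ℝ → ℝ) : ℕ → List ℤ → ℝ
  | _, [] => 0
  | k, a :: l => (a:ℝ) * (G ((k+1:ℕ)/N) - G ((k:ℝ)/N)) + S N G (k+1) l

noncomputable def B (G : ℝ → ℝ) : List ℝ → ℝ
  | [] => G 1 / 2
  | x :: t => G x - B G t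

noncomputable def fl (N : ℕ) : ℤ → ℕ → List ℤ → List ℝ
  | _, _, [] => []
  | s, k, a :: l => if a = s then fl N s (k+1) l else ((k:ℝ)/N) :: fl N (-s) (k+1) l

theorem S_neg (N G) (l : List ℤ) : ∀ k, S N G k (l.map (fun a => -a)) = - S N G k l := by
  induction l with
  | nil => intro k; simp [S]
  | cons a t ih => intro k; simp only [List.map_cons, S, ih]; push_cast; ring

theorem S_close (N : ℕ) (hN : 0 < N) (G : ℝ → ℝ) (hG : ∀ a b, |G b - G a| ≤ |b - a|) {X Y : List ℤ} (h : Le X Y)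
    (hv : SV Y) : ∀ k, |S N G k X - S N G k Y| ≤ (X.count 0 : ℝ) / N := by
  induction h with
  | nil => intro k; simp [S]
  | @cons a b l1 l2 hab _ ih =>
    intro k
    have h1 := ih (fun a ha => hv a (by simp [ha])) (k+1)
    simp only [S, List.count_cons]
    have hN' : (0:ℝ) < N := by exact_mod_cast hN
    have h2 : |G ((k+1:ℕ)/N) - G ((k:ℝ)/N)| ≤ 1 / N := by
      refine (hG _ _).trans (le_of_eq ?_)
      rw [← sub_div, abs_div, abs_of_pos hN']; push_cast; simp
    by_cases ha : a = 0
    · subst ha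
      have hb : |(b:ℝ)| ≤ 1 := by
        rcases hv b (by simp) with h | h | h <;> subst h <;> simp
      have h3 : |(b:ℝ) * (G ((k+1:ℕ)/N) - G ((k:ℝ)/N))| ≤ 1 / N := by
        rw [abs_mul]
        calc _ ≤ 1 * |G ((k+1:ℕ)/N) - G ((k:ℝ)/N)| := by gcongr
          _ ≤ _ := by rw [one_mul]; exact h2
      have : (((List.count 0 l1 + if (0:ℤ) == 0 then 1 else 0 : ℕ)) : ℝ) / N = (List.count 0 l1 : ℝ)/N + 1/N := by
        simp [add_div]
      rw [this]
      have e : ((0:ℤ):ℝ) * (G ((k+1:ℕ)/N) - G ((k:ℝ)/N)) + S N G (k+1) l1 - ((b:ℝ) * (G ((k+1:ℕ)/N) - G ((k:ℝ)/N)) + S N G (k+1) l2)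
        = (S N G (k+1) l1 - S N G (k+1) l2) - (b:ℝ) * (G ((k+1:ℕ)/N) - G ((k:ℝ)/N)) := by push_cast; ring
      rw [e]
      exact (abs_sub _ _).trans (add_le_add h1 h3)
    · rw [hab ha]
      simpa [ha] using h1

theorem fl_len (N : ℕ) (l : List ℤ) : ∀ s k, (fl N s k l).length = dd s l := by
  induction l with
  | nil => intro s k; rfl
  | cons a t ih => intro s k; simp only [fl, dd]; split_ifs <;> simp [ih]

theorem fl_sorted (N : ℕ) (hN : 0 < N) (l : List ℤ) : ∀ s k, k + l.length = N →
    (fl N s k l).Pairwise (· ≤ ·) ∧ ∀ x ∈ fl N s k l, (k:ℝ)/N ≤ x ∧ x ≤ 1 := by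
  have hN' : (0:ℝ) < N := by exact_mod_cast hN
  induction l with
  | nil => intro s k _; simp [fl]
  | cons a t ih =>
    intro s k hk
    have mono : (k:ℝ)/N ≤ ((k+1:ℕ):ℝ)/N := by gcongr; simp
    have k1 : (k:ℝ)/N ≤ 1 := by rw [div_le_one hN']; exact_mod_cast (by omega)
    simp only [List.length_cons] at hk
    simp only [fl]
    split_ifs
    · have := ih s (k+1) (by omega)
      exact ⟨this.1, fun x hx => ⟨mono.trans (this.2 x hx).1, (this.2 x hx).2⟩⟩
    · have := ih (-s) (k+1) (by omega)
      refine ⟨List.pairwise_cons.2 ⟨fun x hx => mono.trans (this.2 x hx).1, this.1⟩, ?_⟩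
      intro x hx
      rcases List.mem_cons.1 hx with rfl | hx
      · exact ⟨le_rfl, k1⟩
      · exact ⟨mono.trans (this.2 x hx).1, (this.2 x hx).2⟩

theorem S_eq (N : ℕ) (hN : 0 < N) (G : ℝ → ℝ) (l : List ℤ) : ∀ s k, (∀ a ∈ l, a = s ∨ a = -s) →
    k + l.length = N → S N G k l = (s:ℝ) * (- G ((k:ℝ)/N) + 2 * B G (fl N s k l)) := by
  have hN' : (0:ℝ) < N := by exact_mod_cast hN
  induction l with
  | nil =>
    intro s k _ hk
    have : k = N := by simpa using hk
    subst this
    simp [S, fl, B, div_self hN'.ne']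
    right; ring
  | cons a t ih =>
    intro s k h hk
    simp only [List.length_cons] at hk
    simp only [fl, S]
    split_ifs with h1
    · rw [ih s (k+1) (fun a ha => h a (by simp [ha])) (by omega), h1]; ring
    · have h2 : a = -s := (h a (by simp)).resolve_left h1
      rw [ih (-s) (k+1) (fun a ha => by have := h a (by simp [ha]); rw [neg_neg]; exact this.symm) (by omega), h2]
      simp only [B]; push_cast; ring

theorem B_pad (G : ℝ → ℝ) (m : ℕ) (l : List ℝ) : B G (l ++ List.replicate m 1) = B G l := by
  induction l with
  | nil =>
    induction m with
    | zero => rfl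
    | succ m ih => simp only [List.nil_append, List.replicate_succ, B] at *; rw [ih]; ring
  | cons a t ih => simp only [List.cons_append, B, ih]

theorem B_cont (G : ℝ → ℝ) (hG : Continuous G) (n : ℕ) : Continuous (fun y : Fin n → ℝ => B G (List.ofFn y)) := by
  induction n with
  | zero => simp only [List.ofFn_zero]; exact continuous_const
  | succ n ih =>
    simp only [List.ofFn_succ, B]
    refine (hG.comp (continuous_apply 0)).sub (ih.comp (f := fun y : Fin (n+1) → ℝ => fun i : Fin n => y i.succ) ?_)
    fun_prop

theorem strictify {ι : Type*} (G : ι → ℝ → ℝ) (l : List ℝ) (h : l.Pairwise (· ≤ ·)) (h1 : ∀ x ∈ l, x ≤ 1) :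
    ∃ l' : List ℝ, l'.Sublist l ∧ l'.Pairwise (· < ·) ∧ (∀ x ∈ l', x < 1) ∧ ∀ i, B (G i) l' = B (G i) l := by
  induction l with
  | nil => exact ⟨[], List.Sublist.refl _, List.Pairwise.nil, by simp, fun _ => rfl⟩
  | cons x t ih =>
    rw [List.pairwise_cons] at h
    obtain ⟨t', a1, a2, a3, a4⟩ := ih h.2 (fun x hx => h1 x (by simp [hx]))
    have hx1 := h1 x (by simp)
    cases t' with
    | nil =>
      rcases hx1.lt_or_eq with h5 | h5
      · exact ⟨[x], by simp, by simp, by simpa using h5, fun i => by simp only [B, ← a4]⟩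
      · refine ⟨[], by simp, by simp, by simp, fun i => ?_⟩
        have := a4 i
        simp only [B] at *; rw [← this, h5]; ring
    | cons y u =>
      have hy : x ≤ y := h.1 y (a1.subset (by simp))
      have a2' := List.pairwise_cons.1 a2
      rcases hy.lt_or_eq with h5 | h5
      · refine ⟨x :: y :: u, List.Sublist.cons_cons x a1, List.pairwise_cons.2 ⟨?_, a2⟩, ?_, fun i => ?_⟩
        · intro z hz
          rcases List.mem_cons.1 hz with rfl | hz
          · exact h5
          · exact h5.trans (a2'.1 z hz)
        · intro z hz
          rcases List.mem_cons.1 hz with rfl | hz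
          · exact h5.trans (a3 y (by simp))
          · exact a3 z hz
        · have := a4 i
          simp only [B] at *; rw [this]
      · refine ⟨u, ((List.sublist_cons_self y u).trans a1).trans (List.sublist_cons_self x t), a2'.2, fun z hz => a3 z (by simp [hz]), fun i => ?_⟩
        have := a4 i
        simp only [B] at *; rw [← this, h5]; ring

theorem strictify0 {ι : Type*} (G : ι → ℝ → ℝ) (hG : ∀ i, G i 0 = 0) (l : List ℝ) (h : l.Pairwise (· ≤ ·))
    (h1 : ∀ x ∈ l, 0 ≤ x ∧ x ≤ 1) (hB : ∀ i, B (G i) l = 0) :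
    ∃ l' : List ℝ, l'.length ≤ l.length ∧ l'.Pairwise (· < ·) ∧ (∀ x ∈ l', 0 < x ∧ x < 1) ∧ ∀ i, B (G i) l' = 0 := by
  obtain ⟨l', a1, a2, a3, a4⟩ := strictify G l h (fun x hx => (h1 x hx).2)
  have len := a1.length_le
  cases l' with
  | nil => exact ⟨[], len, a2, by simp, fun i => by rw [a4, hB]⟩
  | cons x t =>
    have a2' := List.pairwise_cons.1 a2
    rcases (h1 x (a1.subset (by simp))).1.lt_or_eq with h5 | h5
    · refine ⟨x :: t, len, a2, ?_, fun i => by rw [a4, hB]⟩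
      intro z hz
      refine ⟨?_, a3 z hz⟩
      rcases List.mem_cons.1 hz with rfl | hz
      · exact h5
      · exact h5.trans (a2'.1 z hz)
    · refine ⟨t, by simp at len; omega, a2'.2, fun z hz => ⟨h5 ▸ a2'.1 z hz, a3 z (by simp [hz])⟩, fun i => ?_⟩
      have := a4 i
      rw [hB, B, ← h5, hG] at this
      linarith

theorem alt_sum (G : ℝ → ℝ) (l : List ℝ) : ∀ a, ∑ j ∈ range (l.length + 1),
    (-1:ℝ)^j * (G ((a :: (l ++ [1])).getD (j+1) 0) - G ((a :: (l ++ [1])).getD j 0)) = - G a + 2 * B G l := by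
  induction l with
  | nil => intro a; simp [B]; ring
  | cons x t ih =>
    intro a
    rw [List.length_cons, Finset.sum_range_succ']
    have := ih x
    simp only [List.cons_append, List.getD_cons_succ, List.getD_cons_zero, pow_succ, B] at *
    simp only [mul_neg_one, neg_mul, Finset.sum_neg_distrib, this]
    ring
end HR
namespace HR
open Finset

theorem Le_ofFn {N : ℕ} {X Y : Fin N → ℤ} (h : ∀ j, X j ≠ 0 → Y j = X j) : Le (List.ofFn X) (List.ofFn Y) := by
  unfold Le
  rw [List.forall₂_iff_get]
  refine ⟨by simp, ?_⟩
  intro i h1 h2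
  simpa using h _

theorem SV_ofFn {N : ℕ} {X : Fin N → ℤ} (h : ∀ j, X j = -1 ∨ X j = 0 ∨ X j = 1) : SV (List.ofFn X) := by
  intro a ha
  rw [List.mem_ofFn] at ha
  obtain ⟨j, rfl⟩ := ha
  exact h j

theorem neg_ofFn {N : ℕ} (X : Fin N → ℤ) : List.ofFn (-X) = (List.ofFn X).map (fun a => -a) := by
  rw [List.map_ofFn]; rfl

open Classical in
noncomputable def idx (n N : ℕ) (G : ℕ → ℝ → ℝ) (l : List ℤ) : ℕ :=
  Classical.epsilon (fun i => i < n ∧ (n:ℝ)/N < |S N (G i) 0 l|)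

open Classical in
noncomputable def lb (n N : ℕ) (G : ℕ → ℝ → ℝ) (l : List ℤ) : ℤ :=
  if dd 1 l ≤ n ∨ dd (-1) l ≤ n then
    (if 0 < S N (G (idx n N G l)) 0 l then (idx n N G l : ℤ) + 1 else -((idx n N G l : ℤ) + 1))
  else if dd 1 l < dd (-1) l then (dd 1 l : ℤ) else -(dd (-1) l : ℤ)

theorem exists_X (n N : ℕ) (hN : n < N) (G : ℕ → ℝ → ℝ) (hG : ∀ i a b, |G i b - G i a| ≤ |b - a|) :
    ∃ X : Fin N → ℤ, (∀ j, X j = -1 ∨ X j = 0 ∨ X j = 1) ∧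
      (dd 1 (List.ofFn X) ≤ n ∨ dd (-1) (List.ofFn X) ≤ n) ∧ ∀ i < n, |S N (G i) 0 (List.ofFn X)| ≤ (n:ℝ)/N := by
  by_contra hcon
  have hid : ∀ X : Fin N → ℤ, (∀ j, X j = -1 ∨ X j = 0 ∨ X j = 1) →
      (dd 1 (List.ofFn X) ≤ n ∨ dd (-1) (List.ofFn X) ≤ n) →
      idx n N G (List.ofFn X) < n ∧ (n:ℝ)/N < |S N (G (idx n N G (List.ofFn X))) 0 (List.ofFn X)| := by
    intro X h1 h2
    have : ∃ i, i < n ∧ (n:ℝ)/N < |S N (G i) 0 (List.ofFn X)| := by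
      by_contra h3
      push Not at h3
      exact hcon ⟨X, h1, h2, h3⟩
    exact Classical.epsilon_spec this
  have hNn : 0 < N := by omega
  have dpos : (0:ℝ) ≤ (n:ℝ)/N := by positivity
  have hex : ∀ X : Fin N → ℤ, X ≠ 0 → ∃ a ∈ List.ofFn X, a ≠ 0 := by
    intro X hX
    obtain ⟨j, hj⟩ := Function.ne_iff.1 hX
    exact ⟨X j, by simp [List.mem_ofFn], hj⟩
  have hTL : TL (fun X : Fin N → ℤ => lb n N G (List.ofFn X)) := by
    constructor
    · intro X hX hX0
      simp only [neg_ofFn]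
      have hne := dd_ne _ (SV_ofFn hX) (hex X hX0)
      have hd := hid X hX
      generalize List.ofFn X = l at *
      have d1 : dd 1 (l.map (fun a => -a)) = dd (-1) l := by simpa using dd_neg l (-1)
      have d2 : dd (-1) (l.map (fun a => -a)) = dd 1 l := dd_neg l 1
      have hi : idx n N G (l.map (fun a => -a)) = idx n N G l := by
        unfold idx; simp only [S_neg, abs_neg]
      unfold lb
      rw [d1, d2, hi, S_neg]
      by_cases hc : dd 1 l ≤ n ∨ dd (-1) l ≤ n
      · rw [if_pos hc, if_pos hc.symm]
        have h5 := (hd hc).2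
        have h6 : S N (G (idx n N G l)) 0 l ≠ 0 := by
          intro h; rw [h, abs_zero] at h5; linarith
        rcases lt_or_gt_of_ne h6 with h | h
        · rw [if_pos (by linarith), if_neg (by linarith)]; ring
        · rw [if_neg (by linarith), if_pos (by linarith)]
      · rw [if_neg hc, if_neg (fun h => hc h.symm)]
        rcases lt_or_gt_of_ne hne with h | h
        · split_ifs <;> omega
        · split_ifs <;> omega
    · intro X Y hX hY hX0 hY0 hXY
      have hle := Le_ofFn hXY
      have hneX := dd_ne _ (SV_ofFn hX) (hex X hX0)
      have hneY := dd_ne _ (SV_ofFn hY) (hex Y hY0)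
      have hdX := hid X hX
      have hdY := hid Y hY
      have hvY := SV_ofFn hY
      generalize List.ofFn X = l at *
      generalize List.ofFn Y = l' at *
      have m1 := dd_mono hle 1 (by decide)
      have m2 := dd_mono hle (-1) (by decide)
      have c1 := dd_close l 1
      have c2 := dd_close l (-1)
      have c3 := dd_close l' 1
      have c4 := dd_close l' (-1)
      rw [neg_neg] at c2 c4
      unfold lb
      by_cases hc : dd 1 l ≤ n ∨ dd (-1) l ≤ n
      · have hc' : dd 1 l' ≤ n ∨ dd (-1) l' ≤ n := by omega
        rw [if_pos hc, if_pos hc']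
        obtain ⟨a1, a2⟩ := hdX hc
        obtain ⟨b1, b2⟩ := hdY hc'
        intro heq
        have hcount : (l.count 0 : ℝ) / N ≤ (n:ℝ)/N := by
          have z1 := dd_zero l 1 (by decide)
          have z2 := dd_zero l (-1) (by decide)
          have : l.count 0 ≤ n := by omega
          gcongr
        have hcl := fun i => (S_close N hNn (G i) (hG i) hle hvY 0).trans hcount
        have hii : idx n N G l = idx n N G l' := by split_ifs at heq <;> omega
        rw [hii] at a2 heq
        have hcl := hcl (idx n N G l')
        rw [abs_le] at hcl
        rw [lt_abs] at a2 b2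
        split_ifs at heq with p1 p2 p2
        · omega
        · rcases a2 with a2 | a2 <;> rcases b2 with b2 | b2 <;> linarith
        · rcases a2 with a2 | a2 <;> rcases b2 with b2 | b2 <;> linarith
        · omega
      · rw [if_neg hc]
        by_cases hc' : dd 1 l' ≤ n ∨ dd (-1) l' ≤ n
        · rw [if_pos hc']
          have := (hdY hc').1
          split_ifs <;> omega
        · rw [if_neg hc']
          split_ifs <;> omega
  have := tucker (m := N - 1) hTL (by
    intro X hX hX0
    have hne := dd_ne _ (SV_ofFn hX) (hex X hX0)
    have hd := hid X hX
    have l1 := dd_len (List.ofFn X) 1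
    have l2 := dd_len (List.ofFn X) (-1)
    rw [List.length_ofFn] at l1 l2
    generalize List.ofFn X = l at *
    unfold lb
    rw [abs_le]
    split_ifs with h1
    · have := (hd h1).1; omega
    · have := (hd h1).1; omega
    · omega
    · omega)
  omega

def KK (n : ℕ) : Set (Fin n → ℝ) := {y | Monotone y} ∩ Set.Icc 0 1

theorem KK_compact (n : ℕ) : IsCompact (KK n) := by
  refine IsCompact.inter_left isCompact_Icc ?_
  have : {y : Fin n → ℝ | Monotone y} = ⋂ i, ⋂ j, ⋂ (_ : i ≤ j), {y | y i ≤ y j} := by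
    ext y; simp [Monotone]
  rw [this]
  refine isClosed_iInter fun i => isClosed_iInter fun j => isClosed_iInter fun _ => ?_
  exact isClosed_le (continuous_apply i) (continuous_apply j)

theorem approx (n N : ℕ) (hN : n < N) (G : ℕ → ℝ → ℝ) (hG : ∀ i a b, |G i b - G i a| ≤ |b - a|)
    (hG0 : ∀ i, G i 0 = 0) : ∃ y ∈ KK n, ∀ i < n, |B (G i) (List.ofFn y)| ≤ (n:ℝ)/N := by
  obtain ⟨X, hX, hd, hS⟩ := exists_X n N hN G hG
  have hNn : 0 < N := by omega
  let Y : Fin N → ℤ := fun j => if X j = 0 then 1 else X j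
  have hY : ∀ j, Y j = 1 ∨ Y j = -1 := by
    intro j; have := hX j; simp only [Y]; split_ifs <;> omega
  have hle : Le (List.ofFn X) (List.ofFn Y) := Le_ofFn (by intro j hj; simp [Y, hj])
  have hvY : SV (List.ofFn Y) := SV_ofFn (by intro j; have := hY j; omega)
  have hlen : (List.ofFn Y).length = N := by simp
  have hYm : ∀ a ∈ List.ofFn Y, a = 1 ∨ a = -1 := by
    intro a ha; rw [List.mem_ofFn] at ha; obtain ⟨j, rfl⟩ := ha; exact hY j
  have hcount : ((List.ofFn X).count 0 : ℝ) / N ≤ (n:ℝ)/N := by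
    have z1 := dd_zero (List.ofFn X) 1 (by decide)
    have z2 := dd_zero (List.ofFn X) (-1) (by decide)
    have : (List.ofFn X).count 0 ≤ n := by omega
    gcongr
  have hSY : ∀ i < n, |S N (G i) 0 (List.ofFn Y)| ≤ 2 * ((n:ℝ)/N) := by
    intro i hi
    have h1 := abs_le.1 ((S_close N hNn (G i) (hG i) hle hvY 0).trans hcount)
    have h2 := abs_le.1 (hS i hi)
    rw [abs_le]; constructor <;> linarith
  obtain ⟨s, hs, hsn⟩ : ∃ s : ℤ, (s = 1 ∨ s = -1) ∧ dd s (List.ofFn Y) ≤ n := by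
    rcases hd with h | h
    · exact ⟨1, Or.inl rfl, (dd_mono hle 1 (by decide)).trans h⟩
    · exact ⟨-1, Or.inr rfl, (dd_mono hle (-1) (by decide)).trans h⟩
  have hYs : ∀ a ∈ List.ofFn Y, a = s ∨ a = -s := by
    intro a ha; have := hYm a ha; omega
  generalize List.ofFn Y = l at *
  have hsort := fl_sorted N hNn l s 0 (by omega)
  have hfl := fl_len N l s 0
  let L := fl N s 0 l ++ List.replicate (n - dd s l) 1
  have hL : L.length = n := by simp [L, hfl]; omega
  have hLs : L.Pairwise (· ≤ ·) := by
    rw [List.pairwise_append]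
    refine ⟨hsort.1, by simp [List.pairwise_replicate], ?_⟩
    intro a ha b hb
    rw [List.eq_of_mem_replicate hb]; exact (hsort.2 a ha).2
  have hL01 : ∀ x ∈ L, 0 ≤ x ∧ x ≤ 1 := by
    intro x hx
    rcases List.mem_append.1 hx with h | h
    · simpa using hsort.2 x h
    · rw [List.eq_of_mem_replicate h]; simp
  have hBL : ∀ i < n, |B (G i) L| ≤ (n:ℝ)/N := by
    intro i hi
    have h1 := hSY i hi
    rw [S_eq N hNn (G i) l s 0 hYs (by omega)] at h1
    simp only [L, B_pad]
    simp only [Nat.cast_zero, zero_div, hG0, neg_zero, zero_add] at h1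
    rw [abs_mul, abs_mul] at h1
    have : |(s:ℝ)| = 1 := by rcases hs with h | h <;> rw [h] <;> simp
    rw [this] at h1
    norm_num at h1
    linarith
  clear_value L
  subst hL
  refine ⟨L.get, ⟨?_, ?_⟩, ?_⟩
  · have := List.pairwise_iff_get.1 hLs
    intro i j hij
    rcases hij.lt_or_eq with h | h
    · exact this i j h
    · rw [h]
  · exact ⟨fun i => (hL01 _ (List.get_mem L i)).1, fun i => (hL01 _ (List.get_mem L i)).2⟩
  · rw [List.ofFn_get]; exact hBL

theorem exact_list (n : ℕ) (G : ℕ → ℝ → ℝ) (hG : ∀ i a b, |G i b - G i a| ≤ |b - a|)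
    (hG0 : ∀ i, G i 0 = 0) : ∃ l : List ℝ, l.length ≤ n ∧ l.Pairwise (· < ·) ∧ (∀ x ∈ l, 0 < x ∧ x < 1) ∧
      ∀ i < n, B (G i) l = 0 := by
  have hcont : ∀ i, Continuous (G i) := fun i => by
    have : LipschitzWith 1 (G i) := LipschitzWith.of_dist_le_mul (fun a b => by
      rw [Real.dist_eq, Real.dist_eq]; simpa using hG i b a)
    exact this.continuous
  let φ : (Fin n → ℝ) → ℝ := fun y => ∑ i ∈ range n, |B (G i) (List.ofFn y)|
  have hφ : Continuous φ := continuous_finsetSum _ (fun i _ => (B_cont (G i) (hcont i) n).abs)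
  obtain ⟨y0, hy0, _⟩ := approx n (n+1) (by omega) G hG hG0
  obtain ⟨y, hy, hmin⟩ := (KK_compact n).exists_isMinOn ⟨y0, hy0⟩ hφ.continuousOn
  have hle : φ y ≤ 0 := by
    refine ge_of_tendsto (f := fun N : ℕ => ((n:ℝ) * n) / N) (x := Filter.atTop) (tendsto_const_div_atTop_nhds_zero_nat _) ?_
    filter_upwards [Filter.eventually_gt_atTop n] with N hN
    obtain ⟨z, hz, hz'⟩ := approx n N hN G hG hG0
    refine (hmin hz).trans ?_
    calc φ z ≤ ∑ i ∈ range n, (n:ℝ)/N := Finset.sum_le_sum (fun i hi => hz' i (by simpa using hi))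
      _ = _ := by simp; ring
  have hz : ∀ i < n, B (G i) (List.ofFn y) = 0 := by
    intro i hi
    have h0 : φ y = 0 := le_antisymm hle (Finset.sum_nonneg (fun _ _ => abs_nonneg _))
    have := (Finset.sum_eq_zero_iff_of_nonneg (fun _ _ => abs_nonneg _)).1 h0 i (by simpa using hi)
    exact abs_eq_zero.1 this
  obtain ⟨l', a1, a2, a3, a4⟩ := strictify0 (fun i : Fin n => G i) (fun i => hG0 i) (List.ofFn y)
    (List.pairwise_ofFn.2 (fun i j hij => hy.1 hij.le))
    (by intro x hx; rw [List.mem_ofFn] at hx; obtain ⟨j, rfl⟩ := hx; exact ⟨hy.2.1 j, hy.2.2 j⟩)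
    (fun i => hz i i.2)
  exact ⟨l', by simpa using a1, a2, a3, fun i hi => a4 ⟨i, hi⟩⟩

theorem step_int (f : ℝ → ℝ) (k : ℕ) (p : Fin (k + 1) → ℝ) (c : Fin k → ℝ) (hp : Monotone p)
    (h : ∀ j : Fin k, ∀ t ∈ Set.Ioo (p j.castSucc) (p j.succ), f t = c j) :
    IntervalIntegrable f MeasureTheory.volume (p 0) (p (Fin.last k)) := by
  induction k with
  | zero => simp
  | succ k ih =>
    have h1 := ih (fun j => p j.castSucc) (fun j => c j.castSucc)
      (fun i j hij => hp (Fin.castSucc_le_castSucc_iff.2 hij)) (fun j t ht => h j.castSucc t ht)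
    refine IntervalIntegrable.trans h1 ?_
    have hle : p (Fin.last k).castSucc ≤ p (Fin.last (k+1)) := hp (Fin.le_last _)
    rw [intervalIntegrable_iff_integrableOn_Ioo_of_le hle]
    refine MeasureTheory.IntegrableOn.congr_fun (f := fun _ => c (Fin.last k)) ?_ ?_ measurableSet_Ioo
    · exact MeasureTheory.integrableOn_const (by simp)
    · intro t ht; exact (h (Fin.last k) t ht).symm

end HR

open MeasureTheory intervalIntegral

/-- Hobby–Rice for step functions with values in `{-1,0,1}`:
there are points `0 = x_0 < x_1 < ⋯ < x_r < x_{r+1} = 1` with `r ≤ n` such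
that the alternating sums of the integrals of each `g i` vanish. -/
theorem stmt14 (n : ℕ) (g : Fin n → ℝ → ℝ)
    (hval : ∀ i t, g i t ∈ ({-1, 0, 1} : Set ℝ))
    (hstep : ∀ i, ∃ (k : ℕ) (p : Fin (k + 1) → ℝ) (c : Fin k → ℝ),
      Monotone p ∧ p 0 = 0 ∧ p (Fin.last k) = 1 ∧
      ∀ j : Fin k, ∀ t ∈ Set.Ioo (p j.castSucc) (p j.succ), g i t = c j) :
    ∃ (r : ℕ) (x : Fin (r + 2) → ℝ), r ≤ n ∧ StrictMono x ∧
      x 0 = 0 ∧ x (Fin.last (r + 1)) = 1 ∧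
      ∀ i, ∑ j : Fin (r + 1),
        (-1 : ℝ) ^ ((j : ℕ) + 1) * ∫ t in (x j.castSucc)..(x j.succ), g i t = 0 := by
  have hgInt : ∀ i, IntervalIntegrable (g i) volume 0 1 := by
    intro i
    obtain ⟨k, p, c, h1, h2, h3, h4⟩ := hstep i
    have := HR.step_int (g i) k p c h1 h4
    rwa [h2, h3] at this
  let hh : Fin n → ℝ → ℝ := fun i => Set.indicator (Set.Icc 0 1) (g i)
  have hhi : ∀ i, Integrable (hh i) volume := by
    intro i
    rw [integrable_indicator_iff measurableSet_Icc]
    exact (intervalIntegrable_iff_integrableOn_Icc_of_le zero_le_one).1 (hgInt i)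
  have hhb : ∀ i t, ‖hh i t‖ ≤ 1 := by
    intro i t
    refine (norm_indicator_le_norm_self _ _).trans ?_
    rcases hval i t with h | h | h <;> rw [h] <;> simp
  let G : ℕ → ℝ → ℝ := fun i t => if h : i < n then ∫ u in (0:ℝ)..t, hh ⟨i, h⟩ u else 0
  have hGsub : ∀ (i : Fin n) a b, G i b - G i a = ∫ u in a..b, hh i u := by
    intro i a b
    simp only [G, i.2, dif_pos, Fin.eta]
    exact integral_interval_sub_left (hhi i).intervalIntegrable (hhi i).intervalIntegrable
  have hG : ∀ i a b, |G i b - G i a| ≤ |b - a| := by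
    intro i a b
    by_cases h : i < n
    · rw [hGsub ⟨i, h⟩ a b]
      simpa using intervalIntegral.norm_integral_le_of_norm_le_const (C := 1) (a := a) (b := b)
        (fun t _ => hhb ⟨i, h⟩ t)
    · simp [G, h]
  have hG0 : ∀ i, G i 0 = 0 := by intro i; simp [G]
  obtain ⟨l, h1, h2, h3, h4⟩ := HR.exact_list n G hG hG0
  let P : List ℝ := 0 :: (l ++ [1])
  have hPlen : P.length = l.length + 2 := by simp [P]
  have hPs : P.Pairwise (· < ·) := by
    refine List.pairwise_cons.2 ⟨?_, ?_⟩
    · intro x hx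
      rcases List.mem_append.1 hx with h | h
      · exact (h3 x h).1
      · simp at h; rw [h]; norm_num
    · rw [List.pairwise_append]
      refine ⟨h2, by simp, ?_⟩
      intro a ha b hb
      simp at hb; rw [hb]; exact (h3 a ha).2
  have hP01 : ∀ x ∈ P, 0 ≤ x ∧ x ≤ 1 := by
    intro x hx
    rcases List.mem_cons.1 hx with h | h
    · rw [h]; simp
    rcases List.mem_append.1 h with h | h
    · exact ⟨(h3 x h).1.le, (h3 x h).2.le⟩
    · simp at h; rw [h]; simp
  have hget : ∀ j : Fin (l.length + 2), P.getD j 0 = P.get (j.cast hPlen.symm) := by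
    intro j
    rw [List.getD_eq_getElem _ _ (by rw [hPlen]; exact j.2)]; rfl
  have hmono : StrictMono (fun j : Fin (l.length + 2) => P.getD j 0) := by
    intro i j hij
    simp only [hget]
    exact List.pairwise_iff_get.1 hPs _ _ hij
  refine ⟨l.length, fun j => P.getD j 0, h1, hmono, by simp [P], by simp [P], ?_⟩
  intro i
  have key := HR.alt_sum (G i) l 0
  rw [hG0, h4 i i.2, Finset.sum_range] at key
  have : ∀ j : Fin (l.length + 1), (-1 : ℝ) ^ ((j : ℕ) + 1) *
      ∫ t in (P.getD (j.castSucc : Fin (l.length + 2)) 0)..(P.getD (j.succ : Fin (l.length + 2)) 0), g i t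
      = - ((-1:ℝ)^(j:ℕ) * (G i (P.getD ((j:ℕ)+1) 0) - G i (P.getD (j:ℕ) 0))) := by
    intro j
    have e : ∫ t in (P.getD (j.castSucc : Fin (l.length + 2)) 0)..(P.getD (j.succ : Fin (l.length + 2)) 0), g i t
        = ∫ t in (P.getD (j.castSucc : Fin (l.length + 2)) 0)..(P.getD (j.succ : Fin (l.length + 2)) 0), hh i t := by
      apply intervalIntegral.integral_congr
      intro t ht
      rw [Set.uIcc_of_le (hmono (Fin.castSucc_lt_succ (i := j))).le] at ht
      have q1 := hP01 _ (List.get_mem P (j.castSucc.cast hPlen.symm))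
      have q2 := hP01 _ (List.get_mem P (j.succ.cast hPlen.symm))
      rw [← hget] at q1 q2
      exact (Set.indicator_of_mem (s := Set.Icc (0:ℝ) 1) ⟨q1.1.trans ht.1, ht.2.trans q2.2⟩ (g i)).symm
    rw [e, ← hGsub i, pow_succ]
    simp
  rw [Finset.sum_congr rfl (fun j _ => this j), Finset.sum_neg_distrib]
  have key' : ∑ j : Fin (l.length + 1), (-1:ℝ)^(j:ℕ) * (G i (P.getD ((j:ℕ)+1) 0) - G i (P.getD (j:ℕ) 0)) = 0 := by
    rw [key]; simp
  rw [key', neg_zero]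
end

section
/- Consider a necklace, i.e., a finite sequence w of m beads, each bead having a type in [n] and a sign in {+1,-1}. Then w can be split by at most n cuts into consecutive segments alternately assigned to two thieves so that for each type i, the signed amounts (number of positive beads minus negative beads of type i) received by the two thieves differ by at most one; moreover, for each type whose total signed amount has odd parity difference, one can prescribe which thief receives the extra unit. -/
/-- The signed amount of beads of type `i` within the set `P` of positions of the
necklace `w`. A bead is a pair `(i, b)`: type `i`, positive iff `b = true`. -/
def amt {n m : ℕ} (w : Fin m → Fin n × Bool) (i : Fin n) (P : Finset (Fin m)) : ℤ :=
  ∑ p ∈ P, (if w p = (i, true) then 1 else if w p = (i, false) then -1 else 0)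

theorem even_sum_aux {s : Finset ℕ} (f : ℕ → ℤ) (hf : ∀ p ∈ s, Odd (f p)) :
    Even (∑ p ∈ s, f p) ↔ Even s.card := by
  have h : Even (∑ p ∈ s, (f p - 1)) := by
    refine Finset.even_sum _ (fun p hp => ?_)
    obtain ⟨r, hr⟩ := hf p hp
    exact ⟨r, by omega⟩
  rw [Finset.sum_sub_distrib] at h
  simp only [Finset.sum_const, nsmul_eq_mul, mul_one] at h
  rw [Int.even_sub] at h
  rw [h, Int.even_coe_nat]

theorem odd_sum_aux {s : Finset ℕ} (f : ℕ → ℤ) (hs : Odd s.card) (hf : ∀ p ∈ s, Odd (f p)) :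
    Odd (∑ p ∈ s, f p) := by
  rw [← Int.not_even_iff_odd, even_sum_aux f hf, Nat.not_even_iff_odd]
  exact hs

def nkS (t p : ℕ) : ℤ := if p < t then 1 else if p = t then 0 else -1
def nkR (q p : ℕ) : ℤ := if p < q then 1 else -1
def nkSig {k : ℕ} (T : Fin k → ℕ) (p : ℕ) : ℤ := ∏ i, nkS (T i) p
def nkG (m : ℕ) (ty : ℕ → ℕ) (e : ℕ → ℤ) {k : ℕ} (T : Fin k → ℕ) (j : ℕ) : ℤ :=
  ∑ p ∈ (Finset.range m).filter (fun p => ty p = j), e p * nkSig T p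
def nkH (m : ℕ) (ty : ℕ → ℕ) (e : ℕ → ℤ) {k : ℕ} (T : Fin k → ℕ) (q j : ℕ) : ℤ :=
  ∑ p ∈ (Finset.range m).filter (fun p => ty p = j), e p * (nkR q p * nkSig T p)
def nkK (m : ℕ) (ty : ℕ → ℕ) (e : ℕ → ℤ) {k : ℕ} (T : Fin k → ℕ) (b j : ℕ) : ℤ :=
  ∑ p ∈ (Finset.range m).filter (fun p => ty p = j), e p * (nkS b p * nkSig T p)
def nkA (m : ℕ) (ty : ℕ → ℕ) (k : ℕ) : Finset (Fin k → ℕ) :=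
  Fintype.piFinset (fun i : Fin k => (Finset.range m).filter (fun p => ty p = i))
open Classical in
noncomputable def nkg (m : ℕ) (ty : ℕ → ℕ) (e : ℕ → ℤ) {k : ℕ} (T : Fin k → ℕ) (q : ℕ) : ZMod 2 :=
  if (∀ i : Fin k, nkH m ty e T q i = 0) ∧ 0 < nkH m ty e T q k then 1 else 0
open Classical in
noncomputable def nkN (m : ℕ) (ty : ℕ → ℕ) (e : ℕ → ℤ) (k : ℕ) : ZMod 2 :=
  ∑ T ∈ nkA m ty k, if (∀ i : Fin k, nkG m ty e T i = 0) then 1 else 0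

theorem nkS_ne {t p : ℕ} (h : p ≠ t) : nkS t p = 1 ∨ nkS t p = -1 := by
  unfold nkS; split_ifs <;> simp

theorem nkS_self (t : ℕ) : nkS t t = 0 := by simp [nkS]

theorem nkR_cases (q p : ℕ) : nkR q p = 1 ∨ nkR q p = -1 := by
  unfold nkR; split_ifs <;> simp

theorem unit_prod {ι : Type*} (s : Finset ι) (f : ι → ℤ) (h : ∀ i ∈ s, f i = 1 ∨ f i = -1) :
    (∏ i ∈ s, f i) = 1 ∨ (∏ i ∈ s, f i) = -1 := by
  have : IsUnit (∏ i ∈ s, f i) := by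
    rw [IsUnit.prod_iff]
    intro i hi
    exact Int.isUnit_iff.2 (h i hi)
  exact Int.isUnit_iff.1 this

theorem nkSig_unit {k : ℕ} (T : Fin k → ℕ) (p : ℕ) (h : ∀ i, p ≠ T i) :
    nkSig T p = 1 ∨ nkSig T p = -1 :=
  unit_prod _ _ (fun i _ => nkS_ne (h i))

theorem nkSig_zero {k : ℕ} (T : Fin k → ℕ) (i : Fin k) : nkSig T (T i) = 0 :=
  Finset.prod_eq_zero (Finset.mem_univ i) (nkS_self _)

theorem mem_nkA {m : ℕ} {ty : ℕ → ℕ} {k : ℕ} {T : Fin k → ℕ} :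
    T ∈ nkA m ty k ↔ ∀ i, T i < m ∧ ty (T i) = i := by
  simp [nkA]

section
variable (m : ℕ) (ty : ℕ → ℕ) (e : ℕ → ℤ) {k : ℕ} (T : Fin k → ℕ)

theorem nkH_zero (j : ℕ) : nkH m ty e T 0 j = - nkG m ty e T j := by
  simp [nkH, nkG, nkR]

theorem nkH_last (j : ℕ) : nkH m ty e T m j = nkG m ty e T j := by
  unfold nkH nkG
  refine Finset.sum_congr rfl fun p hp => ?_
  have : p < m := by simp at hp; exact hp.1
  simp [nkR, this]

theorem nkH_succ (b j : ℕ) (hb : b < m) : nkH m ty e T (b + 1) j =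
    nkK m ty e T b j + if ty b = j then e b * nkSig T b else 0 := by
  unfold nkH nkK
  have : (if ty b = j then e b * nkSig T b else 0) =
      ∑ p ∈ (Finset.range m).filter (fun p => ty p = j), if p = b then e b * nkSig T b else 0 := by
    rw [Finset.sum_ite_eq']; simp [hb]
  rw [this, ← Finset.sum_add_distrib]
  refine Finset.sum_congr rfl fun p hp => ?_
  unfold nkR nkS
  rcases lt_trichotomy p b with h | h | h
  · simp [h, h.ne, Nat.lt_succ_of_lt h]
  · subst h; simp
  · simp [h.ne', not_lt.2 h.le, not_lt.2 (Nat.succ_le_of_lt h)]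

theorem nkH_self (b j : ℕ) (hb : b < m) : nkH m ty e T b j =
    nkK m ty e T b j - if ty b = j then e b * nkSig T b else 0 := by
  unfold nkH nkK
  have : (if ty b = j then e b * nkSig T b else 0) =
      ∑ p ∈ (Finset.range m).filter (fun p => ty p = j), if p = b then e b * nkSig T b else 0 := by
    rw [Finset.sum_ite_eq']; simp [hb]
  rw [this, ← Finset.sum_sub_distrib]
  refine Finset.sum_congr rfl fun p hp => ?_
  unfold nkR nkS
  rcases lt_trichotomy p b with h | h | h
  · simp [h, h.ne]
  · subst h; simp
  · simp [h.ne', not_lt.2 h.le]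

theorem nkSig_update (i : Fin k) (b p : ℕ) :
    nkS (T i) p * nkSig (Function.update T i b) p = nkS b p * nkSig T p := by
  unfold nkSig
  rw [← Finset.mul_prod_erase _ _ (Finset.mem_univ i), ← Finset.mul_prod_erase (a := i) _
    (fun i => nkS (T i) p) (Finset.mem_univ i)]
  have : ∏ x ∈ Finset.univ.erase i, nkS (Function.update T i b x) p
      = ∏ x ∈ Finset.univ.erase i, nkS (T x) p := by
    refine Finset.prod_congr rfl fun x hx => ?_
    rw [Function.update_of_ne (Finset.ne_of_mem_erase hx)]
  rw [this, Function.update_self]; ring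

theorem nkK_update (i : Fin k) (b j : ℕ) :
    nkK m ty e (Function.update T i b) (T i) j = nkK m ty e T b j := by
  unfold nkK
  refine Finset.sum_congr rfl fun p _ => ?_
  rw [nkSig_update]

theorem nkG_snoc (b j : ℕ) :
    nkG m ty e (Fin.snoc (α := fun _ => ℕ) T b : Fin (k+1) → ℕ) j = nkK m ty e T b j := by
  unfold nkK nkG
  refine Finset.sum_congr rfl fun p _ => ?_
  simp [nkSig, Fin.prod_univ_castSucc, mul_comm]

open Classical in
theorem nkD_lt (he : ∀ p, e p = 1 ∨ e p = -1) (b : ℕ) (hb : b < m) (i : Fin k)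
    (hi : ty b = i) (hT : ∀ j, b ≠ T j) :
    nkg m ty e T b + nkg m ty e T (b + 1) =
     if (∀ j : Fin k, j ≠ i → nkK m ty e T b j = 0) ∧
      (nkK m ty e T b i = 1 ∨ nkK m ty e T b i = -1) ∧ 0 < nkK m ty e T b k then 1 else 0 := by
  have hu : e b * nkSig T b = 1 ∨ e b * nkSig T b = -1 := by
    rcases he b with h | h <;> rcases nkSig_unit T b hT with h' | h' <;> simp [h, h']
  have hk : ty b ≠ k := by rw [hi]; exact i.2.ne
  have key : ∀ q : ℕ, ∀ c : ℤ, (∀ j, nkH m ty e T q j = nkK m ty e T b j + if ty b = j then c else 0) →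
     nkg m ty e T q = if (∀ j : Fin k, j ≠ i → nkK m ty e T b j = 0) ∧
      (nkK m ty e T b i = -c) ∧ 0 < nkK m ty e T b k then 1 else 0 := by
    intro q c h
    unfold nkg
    congr 1
    rw [h k, if_neg hk, add_zero, ← and_assoc]
    apply propext
    refine and_congr_left fun _ => ?_
    constructor
    · intro h'
      refine ⟨fun j hj => ?_, ?_⟩
      · have := h' j
        rw [h, if_neg, add_zero] at this
        · exact this
        · rw [hi]; exact fun h => hj (Fin.ext h.symm)
      · have := h' i
        rw [h, if_pos hi] at this
        linarith
    · rintro ⟨h1, h2⟩ j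
      rw [h]
      by_cases hj : j = i
      · subst hj; rw [if_pos hi]; linarith
      · rw [h1 j hj, if_neg]; · rfl
        rw [hi]; exact fun h => hj (Fin.ext h.symm)
  rw [key b (-(e b * nkSig T b)) (fun j => by rw [nkH_self _ _ _ _ _ _ hb]; split_ifs <;> ring),
    key (b+1) (e b * nkSig T b) (fun j => by rw [nkH_succ _ _ _ _ _ _ hb])]
  by_cases h1 : (∀ j : Fin k, j ≠ i → nkK m ty e T b j = 0)
  · by_cases h2 : 0 < nkK m ty e T b k
    · simp only [h1, h2, and_true, true_and]
      rcases hu with hu | hu <;> rw [hu] <;>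
      rcases eq_or_ne (nkK m ty e T b i) 1 with h3 | h3 <;>
      rcases eq_or_ne (nkK m ty e T b i) (-1) with h4 | h4 <;> simp [h3, h4]
    · simp [h2]
  · simp [h1]

theorem nkD_mem (b : ℕ) (hb : b < m) (j : Fin k) (hT : b = T j) :
    nkg m ty e T b + nkg m ty e T (b + 1) = 0 := by
  have : nkg m ty e T b = nkg m ty e T (b + 1) := by
    unfold nkg
    have : ∀ l, nkH m ty e T b l = nkH m ty e T (b+1) l := by
      intro l
      rw [nkH_self _ _ _ _ _ _ hb, nkH_succ _ _ _ _ _ _ hb, hT, nkSig_zero]; simp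
    simp only [this]
  rw [this]; exact CharTwo.add_self_eq_zero _

theorem nkD_gt (b : ℕ) (hb : b < m) (h : k < ty b) :
    nkg m ty e T b + nkg m ty e T (b + 1) = 0 := by
  have : nkg m ty e T b = nkg m ty e T (b + 1) := by
    unfold nkg
    have : ∀ l ≤ k, nkH m ty e T b l = nkH m ty e T (b+1) l := by
      intro l hl
      rw [nkH_self _ _ _ _ _ _ hb, nkH_succ _ _ _ _ _ _ hb, if_neg (by omega)]; simp
    rw [this k le_rfl]
    have h2 : ∀ i : Fin k, nkH m ty e T b i = nkH m ty e T (b+1) i := fun i => this i i.2.le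
    simp only [h2]
  rw [this]; exact CharTwo.add_self_eq_zero _

open Classical in
theorem nkD_eq (he : ∀ p, e p = 1 ∨ e p = -1) (b : ℕ) (hb : b < m)
    (hi : ty b = k) (hT : T ∈ nkA m ty k)
    (hodd : Odd ((Finset.range m).filter (fun p => ty p = k)).card) :
    nkg m ty e T b + nkg m ty e T (b + 1) =
     if (∀ j : Fin k, nkK m ty e T b j = 0) ∧ nkK m ty e T b k = 0 then 1 else 0 := by
  rw [mem_nkA] at hT
  have hne : ∀ p, ty p = k → ∀ j, p ≠ T j := by
    rintro p hp j rfl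
    have := (hT j).2
    have := j.2
    omega
  have hu : e b * nkSig T b = 1 ∨ e b * nkSig T b = -1 := by
    rcases he b with h | h <;> rcases nkSig_unit T b (hne b hi) with h' | h' <;> simp [h, h']
  have ho : Odd (nkH m ty e T b k) := by
    apply odd_sum_aux _ hodd
    intro p hp
    simp only [Finset.mem_filter] at hp
    rcases he p with h | h <;> rcases nkSig_unit T p (hne p hp.2) with h' | h' <;>
      rcases nkR_cases b p with h'' | h'' <;> simp [h, h', h'']
  have h1 : ∀ j : Fin k, nkH m ty e T b j = nkK m ty e T b j := fun j => by
    rw [nkH_self _ _ _ _ _ _ hb, if_neg, sub_zero]; have := j.2; omega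
  have h2 : ∀ j : Fin k, nkH m ty e T (b+1) j = nkK m ty e T b j := fun j => by
    rw [nkH_succ _ _ _ _ _ _ hb, if_neg, add_zero]; have := j.2; omega
  unfold nkg
  simp only [h1, h2]
  by_cases hz : (∀ j : Fin k, nkK m ty e T b j = 0)
  · simp only [hz, implies_true, true_and]
    rw [nkH_self _ _ _ _ _ _ hb, if_pos hi] at ho ⊢
    rw [nkH_succ _ _ _ _ _ _ hb, if_pos hi]
    obtain ⟨r, hr⟩ := ho
    generalize nkK m ty e T b k = x at *
    generalize e b * nkSig T b = y at *
    by_cases ha : 0 < x - y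
    · by_cases hc : 0 < x + y
      · rw [if_pos ha, if_pos hc, if_neg (by omega)]; rfl
      · rw [if_pos ha, if_neg hc, if_pos (by omega)]; rfl
    · by_cases hc : 0 < x + y
      · rw [if_neg ha, if_pos hc, if_pos (by omega)]; rfl
      · rw [if_neg ha, if_neg hc, if_neg (by omega)]; rfl
  · simp [hz]
end

theorem nk_sum_lt (m : ℕ) (ty : ℕ → ℕ) (e : ℕ → ℤ) (he : ∀ p, e p = 1 ∨ e p = -1) (k : ℕ) :
    ∑ x ∈ (nkA m ty k ×ˢ Finset.range m).filter (fun x => ty x.2 < k),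
      (nkg m ty e x.1 x.2 + nkg m ty e x.1 (x.2 + 1)) = 0 := by
  classical
  refine Finset.sum_involution
    (fun x hx => (Function.update x.1 ⟨ty x.2, (Finset.mem_filter.1 hx).2⟩ x.2,
      x.1 ⟨ty x.2, (Finset.mem_filter.1 hx).2⟩)) ?_ ?_ ?_ ?_
  · rintro ⟨T, b⟩ hx
    have hx' := hx
    simp only [Finset.mem_filter, Finset.mem_product, Finset.mem_range, mem_nkA] at hx'
    obtain ⟨⟨hT, hb⟩, hk⟩ := hx'
    dsimp only
    set i : Fin k := ⟨ty b, hk⟩ with hi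
    by_cases hbi : b = T i
    · rw [← hbi]
      rw [hbi, Function.update_eq_self, ← hbi]; exact CharTwo.add_self_eq_zero _
    have hTi := hT i
    rw [nkD_lt m ty e T he b hb i rfl, nkD_lt m ty e _ he (T i) hTi.1 i hTi.2]
    · simp only [nkK_update]; exact CharTwo.add_self_eq_zero _
    · intro j
      by_cases hj : j = i
      · subst hj; rw [Function.update_self]; exact fun h => hbi h.symm
      · rw [Function.update_of_ne hj]; intro h
        have := (hT j).2
        rw [← h, hTi.2] at this
        exact hj (Fin.ext this.symm)
    · rintro j rfl
      apply hbi
      have : j = i := Fin.ext (hT j).2.symm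
      rw [← this]
  · rintro ⟨T, b⟩ hx hne heq
    have hx' := hx
    simp only [Finset.mem_filter, Finset.mem_product, Finset.mem_range, mem_nkA] at hx'
    obtain ⟨⟨hT, hb⟩, hk⟩ := hx'
    apply hne
    exact nkD_mem m ty e T b hb ⟨ty b, hk⟩ (congrArg Prod.snd heq).symm
  · rintro ⟨T, b⟩ hx
    simp only [Finset.mem_filter, Finset.mem_product, Finset.mem_range, mem_nkA] at hx ⊢
    obtain ⟨⟨hT, hb⟩, hk⟩ := hx
    refine ⟨⟨fun j => ?_, (hT _).1⟩, ?_⟩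
    · by_cases hj : j = ⟨ty b, hk⟩
      · subst hj; rw [Function.update_self]; exact ⟨hb, rfl⟩
      · rw [Function.update_of_ne hj]; exact hT j
    · rw [(hT _).2]; exact hk
  · rintro ⟨T, b⟩ hx
    simp only [Finset.mem_filter, Finset.mem_product, Finset.mem_range, mem_nkA] at hx
    obtain ⟨⟨hT, hb⟩, hk⟩ := hx
    have : (⟨ty (T ⟨ty b, hk⟩), by rw [(hT _).2]; exact hk⟩ : Fin k) = ⟨ty b, hk⟩ :=
      Fin.ext (hT _).2
    simp [this]

theorem nk_sum_eq (m : ℕ) (ty : ℕ → ℕ) (e : ℕ → ℤ) (he : ∀ p, e p = 1 ∨ e p = -1) (k : ℕ)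
    (hodd : Odd ((Finset.range m).filter (fun p => ty p = k)).card) :
    ∑ x ∈ (nkA m ty k ×ˢ Finset.range m).filter (fun x => ty x.2 = k),
      (nkg m ty e x.1 x.2 + nkg m ty e x.1 (x.2 + 1)) = nkN m ty e (k + 1) := by
  classical
  unfold nkN
  refine Finset.sum_bij' (fun x _ => (Fin.snoc (α := fun _ => ℕ) x.1 x.2 : Fin (k+1) → ℕ))
    (fun T _ => (fun i : Fin k => T i.castSucc, T (Fin.last k))) ?_ ?_ ?_ ?_ ?_
  · rintro ⟨T, b⟩ hx
    simp only [Finset.mem_filter, Finset.mem_product, Finset.mem_range, mem_nkA] at hx ⊢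
    obtain ⟨⟨hT, hb⟩, hk⟩ := hx
    intro i
    refine Fin.lastCases ?_ (fun j => ?_) i
    · simp [hb, hk]
    · simpa using hT j
  · intro T hT
    simp only [Finset.mem_filter, Finset.mem_product, Finset.mem_range, mem_nkA] at hT ⊢
    exact ⟨⟨fun i => by simpa using hT i.castSucc, (hT _).1⟩, by simpa using (hT (Fin.last k)).2⟩
  · rintro ⟨T, b⟩ hx
    simp
  · intro T hT
    funext i
    refine Fin.lastCases ?_ (fun j => ?_) i <;> simp
  · rintro ⟨T, b⟩ hx
    simp only [Finset.mem_filter, Finset.mem_product, Finset.mem_range] at hx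
    obtain ⟨⟨hT, hb⟩, hk⟩ := hx
    rw [nkD_eq m ty e T he b hb hk hT hodd]
    simp only [nkG_snoc, Fin.forall_fin_succ']
    simp

theorem nk_step (m : ℕ) (ty : ℕ → ℕ) (e : ℕ → ℤ) (he : ∀ p, e p = 1 ∨ e p = -1) (k : ℕ)
    (hodd : Odd ((Finset.range m).filter (fun p => ty p = k)).card) :
    nkN m ty e (k + 1) = nkN m ty e k := by
  classical
  have h1 : ∑ x ∈ nkA m ty k ×ˢ Finset.range m,
      (nkg m ty e x.1 x.2 + nkg m ty e x.1 (x.2 + 1)) = nkN m ty e (k + 1) := by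
    rw [← Finset.sum_filter_add_sum_filter_not _ (fun x => ty x.2 < k), nk_sum_lt m ty e he,
      zero_add, ← nk_sum_eq m ty e he k hodd]
    symm
    apply Finset.sum_subset
    · intro x hx
      simp only [Finset.mem_filter] at hx ⊢
      exact ⟨hx.1, by omega⟩
    · rintro ⟨T, b⟩ hx hx'
      simp only [Finset.mem_filter, Finset.mem_product, Finset.mem_range] at hx hx'
      apply nkD_gt m ty e T b hx.1.2
      by_contra h
      exact hx' ⟨hx.1, by omega⟩
  rw [← h1, Finset.sum_product, nkN]
  refine Finset.sum_congr rfl fun T hT => ?_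
  have tel : ∑ b ∈ Finset.range m, (nkg m ty e T b + nkg m ty e T (b + 1))
      = nkg m ty e T m - nkg m ty e T 0 := by
    rw [← Finset.sum_range_sub]
    refine Finset.sum_congr rfl fun b _ => ?_
    rw [CharTwo.sub_eq_add, add_comm]
  dsimp only
  rw [tel, CharTwo.sub_eq_add]
  rw [mem_nkA] at hT
  have hne : ∀ p, ty p = k → ∀ j, p ≠ T j := by
    rintro p hp j rfl
    have := (hT j).2
    have := j.2
    omega
  have ho : Odd (nkG m ty e T k) := by
    apply odd_sum_aux _ hodd
    intro p hp
    simp only [Finset.mem_filter] at hp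
    rcases he p with h | h <;> rcases nkSig_unit T p (hne p hp.2) with h' | h' <;>
      simp [h, h']
  unfold nkg
  simp only [nkH_zero, nkH_last, neg_eq_zero]
  by_cases hz : (∀ j : Fin k, nkG m ty e T j = 0)
  · simp only [hz, implies_true, true_and]
    obtain ⟨r, hr⟩ := ho
    by_cases ha : 0 < nkG m ty e T k
    · rw [if_pos ha, if_neg (by omega)]; rfl
    · rw [if_neg ha, if_pos (by omega)]; rfl
  · simp [hz]

/-- Existence of a balanced transversal. -/
theorem nk_exists (m : ℕ) (ty : ℕ → ℕ) (e : ℕ → ℤ) (he : ∀ p, e p = 1 ∨ e p = -1) (n : ℕ)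
    (hodd : ∀ k < n, Odd ((Finset.range m).filter (fun p => ty p = k)).card) :
    ∃ T : Fin n → ℕ, (∀ i, T i < m ∧ ty (T i) = i) ∧ ∀ i : Fin n, nkG m ty e T i = 0 := by
  classical
  have h : ∀ k ≤ n, nkN m ty e k = 1 := by
    intro k
    induction k with
    | zero => intro _; simp [nkN, nkA]
    | succ k ih => intro hk; rw [nk_step m ty e he k (hodd k hk), ih (by omega)]
  by_contra hcon
  have h0 := h n le_rfl
  rw [nkN, Finset.sum_eq_zero] at h0
  · exact zero_ne_one h0
  · intro T hT
    rw [if_neg]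
    intro hz
    exact hcon ⟨T, mem_nkA.1 hT, hz⟩

section
variable (m : ℕ) (ty : ℕ → ℕ) (e : ℕ → ℤ) (W : ℕ → ℤ)

theorem nkX_succ (b j : ℕ) :
    ∑ p ∈ (Finset.range m).filter (fun p => ty p = j), e p * (nkR (b + 1) p * W p) =
    ∑ p ∈ (Finset.range m).filter (fun p => ty p = j), e p * (nkS b p * W p) +
      if b < m ∧ ty b = j then e b * W b else 0 := by
  have : (if b < m ∧ ty b = j then e b * W b else 0) =
      ∑ p ∈ (Finset.range m).filter (fun p => ty p = j), if p = b then e b * W b else 0 := by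
    rw [Finset.sum_ite_eq']; simp
  rw [this, ← Finset.sum_add_distrib]
  refine Finset.sum_congr rfl fun p hp => ?_
  unfold nkR nkS
  rcases lt_trichotomy p b with h | h | h
  · simp [h, h.ne, Nat.lt_succ_of_lt h]
  · subst h; simp
  · simp [h.ne', not_lt.2 h.le, not_lt.2 (Nat.succ_le_of_lt h)]

theorem nkX_self (b j : ℕ) :
    ∑ p ∈ (Finset.range m).filter (fun p => ty p = j), e p * (nkR b p * W p) =
    ∑ p ∈ (Finset.range m).filter (fun p => ty p = j), e p * (nkS b p * W p) -
      if b < m ∧ ty b = j then e b * W b else 0 := by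
  have : (if b < m ∧ ty b = j then e b * W b else 0) =
      ∑ p ∈ (Finset.range m).filter (fun p => ty p = j), if p = b then e b * W b else 0 := by
    rw [Finset.sum_ite_eq']; simp
  rw [this, ← Finset.sum_sub_distrib]
  refine Finset.sum_congr rfl fun p hp => ?_
  unfold nkR nkS
  rcases lt_trichotomy p b with h | h | h
  · simp [h, h.ne]
  · subst h; simp
  · simp [h.ne', not_lt.2 h.le]
end

open Classical in
noncomputable def nkTy {n m : ℕ} (w : Fin m → Fin n × Bool) (p : ℕ) : ℕ :=
  if h : p < m then ((w ⟨p, h⟩).1 : ℕ) else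
    if h : p - m < n then (if Even (amt w ⟨p - m, h⟩ Finset.univ) then p - m else n) else n

def nkE {n m : ℕ} (w : Fin m → Fin n × Bool) (p : ℕ) : ℤ :=
  if h : p < m then (if (w ⟨p, h⟩).2 = true then 1 else -1) else 1

theorem nkE_unit {n m : ℕ} (w : Fin m → Fin n × Bool) (p : ℕ) : nkE w p = 1 ∨ nkE w p = -1 := by
  unfold nkE; split_ifs <;> simp

theorem nk_base {n m : ℕ} (w : Fin m → Fin n × Bool) (i : Fin n) (f : ℕ → ℤ) :
    ∑ p : Fin m, (if w p = (i, true) then 1 else if w p = (i, false) then -1 else 0) * f p =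
    ∑ p ∈ (Finset.range m).filter (fun p => nkTy w p = i), nkE w p * f p := by
  rw [Finset.sum_filter, Finset.sum_range]
  refine Finset.sum_congr rfl fun p _ => ?_
  have h1 : nkTy w p = ((w p).1 : ℕ) := by simp [nkTy]
  have h2 : nkE w p = if (w p).2 = true then 1 else -1 := by simp [nkE]
  rw [h1, h2]
  rcases hw : w p with ⟨x, y⟩
  by_cases hx : x = i
  · subst hx; cases y <;> simp
  · have : (x : ℕ) ≠ i := fun h => hx (Fin.ext h)
    simp [hx, this]

theorem nkTy_ext {n m : ℕ} (w : Fin m → Fin n × Bool) (x : Fin n) (i : Fin n) :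
    nkTy w (m + x) = i ↔ x = i ∧ Even (amt w i Finset.univ) := by
  have hi := i.2
  have hx := x.2
  simp only [nkTy, Nat.not_lt.2 (Nat.le_add_right m x), dif_neg, not_false_eq_true,
    Nat.add_sub_cancel_left, x.2, dif_pos, Fin.eta]
  by_cases h : x = i
  · subst h
    split_ifs with h'
    · simp [h']
    · simp [h']; omega
  · have : (x : ℕ) ≠ i := fun h' => h (Fin.ext h')
    split_ifs with h'
    · simp [h, this]
    · simp [h]; omega

open Classical in
theorem nk_split {n m : ℕ} {M : Type*} [AddCommMonoid M]
    (w : Fin m → Fin n × Bool) (i : Fin n) (f : ℕ → M) :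
    ∑ p ∈ (Finset.range (m + n)).filter (fun p => nkTy w p = i), f p =
    ∑ p ∈ (Finset.range m).filter (fun p => nkTy w p = i), f p +
      if Even (amt w i Finset.univ) then f (m + i) else 0 := by
  rw [Finset.sum_filter, Finset.sum_range_add, ← Finset.sum_filter]
  congr 1
  rw [Finset.sum_range]
  simp only [nkTy_ext]
  by_cases h : Even (amt w i Finset.univ) <;> simp [h]

theorem nk_odd {n m : ℕ} (w : Fin m → Fin n × Bool) (i : Fin n) :
    Odd ((Finset.range (m + n)).filter (fun p => nkTy w p = i)).card := by
  classical
  have h1 : amt w i Finset.univ =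
      ∑ p ∈ (Finset.range m).filter (fun p => nkTy w p = i), nkE w p := by
    have := nk_base w i (fun _ => 1)
    simpa [amt] using this
  have h2 := even_sum_aux (s := (Finset.range m).filter (fun p => nkTy w p = i)) (nkE w)
    (fun p _ => by rcases nkE_unit w p with h | h <;> simp [h])
  rw [← h1] at h2
  rw [Finset.card_eq_sum_ones, nk_split, ← Finset.card_eq_sum_ones]
  by_cases h : Even (amt w i Finset.univ)
  · rw [if_pos h]; exact (h2.1 h).add_one
  · rw [if_neg h, add_zero, ← Nat.not_even_iff_odd]; exact fun h' => h (h2.2 h')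

theorem nk_round {n m : ℕ} (w : Fin m → Fin n × Bool) (T : Fin n → ℕ)
    (hT : ∀ i, T i < m + n ∧ nkTy w (T i) = i) (i : Fin n)
    (hG : nkG (m + n) (nkTy w) (nkE w) T i = 0) (τ : ℤ) (hτ : τ = 1 ∨ τ = -1) :
    ∃ q, (q = T i ∨ q = T i + 1) ∧
      (Even (amt w i Finset.univ) → ∑ p ∈ (Finset.range m).filter (fun p => nkTy w p = i),
        nkE w p * (nkR q p * ∏ j ∈ Finset.univ.erase i, nkS (T j) p) = 0) ∧
      (¬ Even (amt w i Finset.univ) → ∑ p ∈ (Finset.range m).filter (fun p => nkTy w p = i),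
        nkE w p * (nkR q p * ∏ j ∈ Finset.univ.erase i, nkS (T j) p) = τ) := by
  classical
  set W : ℕ → ℤ := fun p => ∏ j ∈ Finset.univ.erase i, nkS (T j) p with hW
  have hsig : ∀ p, nkSig T p = nkS (T i) p * W p := fun p =>
    (Finset.mul_prod_erase _ _ (Finset.mem_univ i)).symm
  have hWu : ∀ p, nkTy w p = i → W p = 1 ∨ W p = -1 := by
    intro p hp
    refine unit_prod _ _ fun j hj => nkS_ne ?_
    rintro rfl
    rw [(hT j).2] at hp
    exact Finset.ne_of_mem_erase hj (Fin.ext hp)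
  unfold nkG at hG
  simp only [hsig] at hG
  rw [nk_split] at hG
  have h1 := nkX_succ m (nkTy w) (nkE w) W (T i) i
  have h0 := nkX_self m (nkTy w) (nkE w) W (T i) i
  have hge : ∀ h : m ≤ T i, T i = m + i ∧ Even (amt w i Finset.univ) := by
    intro h
    obtain ⟨x, hx⟩ := Nat.exists_eq_add_of_le h
    have h2 := hT i
    rw [hx] at h2
    have h3 := (nkTy_ext w ⟨x, by omega⟩ i).1 h2.2
    have h4 := congrArg Fin.val h3.1
    simp only at h4
    exact ⟨by rw [hx, h4], h3.2⟩
  have hu : nkE w (T i) * W (T i) = 1 ∨ nkE w (T i) * W (T i) = -1 := by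
    rcases nkE_unit w (T i) with h | h <;> rcases hWu _ (hT i).2 with h' | h' <;> simp [h, h']
  change ∃ q, (q = T i ∨ q = T i + 1) ∧
      (Even (amt w i Finset.univ) → ∑ p ∈ (Finset.range m).filter (fun p => nkTy w p = i),
        nkE w p * (nkR q p * W p) = 0) ∧
      (¬ Even (amt w i Finset.univ) → ∑ p ∈ (Finset.range m).filter (fun p => nkTy w p = i),
        nkE w p * (nkR q p * W p) = τ)
  set Y := ∑ p ∈ (Finset.range m).filter (fun p => nkTy w p = i), nkE w p * (nkS (T i) p * W p)
  by_cases hm : T i < m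
  · rw [if_pos ⟨hm, (hT i).2⟩] at h0 h1
    by_cases hev : Even (amt w i Finset.univ)
    · rw [if_pos hev] at hG
      have hs : nkS (T i) (m + i) = -1 := by
        unfold nkS; rw [if_neg (by omega), if_neg (by omega)]
      have he : nkE w (m + i) = 1 := by simp [nkE]
      have hw2 := hWu (m + i) ((nkTy_ext w i i).2 ⟨rfl, hev⟩)
      rw [hs, he] at hG
      by_cases hc : Y + nkE w (T i) * W (T i) = 0
      · exact ⟨T i + 1, Or.inr rfl, fun _ => by rw [h1, hc], fun h => absurd hev h⟩
      · exact ⟨T i, Or.inl rfl, fun _ => by rw [h0]; omega, fun h => absurd hev h⟩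
    · rw [if_neg hev] at hG
      by_cases hc : Y + nkE w (T i) * W (T i) = τ
      · exact ⟨T i + 1, Or.inr rfl, fun h => absurd h hev, fun _ => by rw [h1, hc]⟩
      · exact ⟨T i, Or.inl rfl, fun h => absurd h hev, fun _ => by rw [h0]; omega⟩
  · obtain ⟨h2, hev⟩ := hge (by omega)
    rw [if_neg (by tauto)] at h0
    rw [if_pos hev, ← h2, nkS_self] at hG
    exact ⟨T i, Or.inl rfl, fun _ => by rw [h0]; linarith, fun h => absurd hev h⟩

theorem nk_cuts {n m : ℕ} (w : Fin m → Fin n × Bool) (τ : Fin n → ℤ)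
    (hτ : ∀ i, τ i = 1 ∨ τ i = -1) :
    ∃ a : Fin n → ℕ, ∀ i,
      (Even (amt w i Finset.univ) →
        ∑ p : Fin m, (if w p = (i, true) then 1 else if w p = (i, false) then -1 else 0) *
          ∏ j, nkR (a j) p = 0) ∧
      (¬ Even (amt w i Finset.univ) →
        ∑ p : Fin m, (if w p = (i, true) then 1 else if w p = (i, false) then -1 else 0) *
          ∏ j, nkR (a j) p = τ i) := by
  obtain ⟨T, hT, hG⟩ := nk_exists (m + n) (nkTy w) (nkE w) (nkE_unit w) n
    (fun k hk => nk_odd w ⟨k, hk⟩)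
  choose a ha hr using fun i => nk_round w T hT i (hG i) (τ i) (hτ i)
  refine ⟨a, fun i => ?_⟩
  have key : ∑ p : Fin m, (if w p = (i, true) then 1 else if w p = (i, false) then -1 else 0) *
          ∏ j, nkR (a j) p = ∑ p ∈ (Finset.range m).filter (fun p => nkTy w p = i),
        nkE w p * (nkR (a i) p * ∏ j ∈ Finset.univ.erase i, nkS (T j) p) := by
    rw [nk_base w i (fun p => ∏ j, nkR (a j) p)]
    refine Finset.sum_congr rfl fun p hp => ?_
    rw [← Finset.mul_prod_erase _ _ (Finset.mem_univ i)]
    congr 2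
    refine Finset.prod_congr rfl fun j hj => ?_
    have hne : p ≠ T j := by
      rintro rfl
      have := (Finset.mem_filter.1 hp).2
      rw [(hT j).2] at this
      exact Finset.ne_of_mem_erase hj (Fin.ext this)
    unfold nkR nkS
    rcases ha j with h | h <;> rw [h] <;> split_ifs <;> first | rfl | omega
  rw [key]
  exact hr i

theorem nk_initial (f : ℕ → ℕ) (hf : Monotone f) (m j p : ℕ) (hp : p < m) :
    p < ((Finset.range m).filter (fun x => f x < j)).card ↔ f p < j := by
  constructor
  · intro h
    by_contra hc
    have : (Finset.range m).filter (fun x => f x < j) ⊆ Finset.range p := by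
      intro x hx
      simp only [Finset.mem_filter, Finset.mem_range] at hx ⊢
      by_contra hxp
      have := hf (not_lt.1 hxp)
      omega
    have := Finset.card_le_card this
    rw [Finset.card_range] at this
    omega
  · intro h
    have : Finset.range (p + 1) ⊆ (Finset.range m).filter (fun x => f x < j) := by
      intro x hx
      simp only [Finset.mem_filter, Finset.mem_range] at hx ⊢
      have := hf (Nat.lt_succ_iff.1 hx)
      omega
    have := Finset.card_le_card this
    rw [Finset.card_range] at this
    omega

/-- necklace splitting with signed beads, with prescription `d` of
which thief gets the extra unit for each type: there are at most `n` cuts,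
i.e., cut points `0 = c_0 ≤ c_1 ≤ ⋯ ≤ c_{n+1} = m`, the segments
`[c_j, c_{j+1})` being assigned alternately to thieves `0` and `1`, such that
for each type the signed amounts received by the thieves differ by at most one,
with equality when the total signed amount is even and otherwise with the
prescribed thief `d i` receiving one more unit. -/
theorem stmt15 (n m : ℕ) (w : Fin m → Fin n × Bool) (d : Fin n → Fin 2) :
    ∃ c : Fin (n + 2) → ℕ, Monotone c ∧ c 0 = 0 ∧ c (Fin.last (n + 1)) = m ∧
      ∀ i : Fin n,
        ∀ thief : ℕ → Finset (Fin m),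
          (∀ t, thief t = Finset.univ.filter (fun p : Fin m =>
            ∃ j : Fin (n + 1), c j.castSucc ≤ (p : ℕ) ∧ (p : ℕ) < c j.succ ∧
              (j : ℕ) % 2 = t)) →
          (Even (amt w i Finset.univ) → amt w i (thief 0) = amt w i (thief 1)) ∧
          (¬ Even (amt w i Finset.univ) →
            amt w i (thief (d i)) = amt w i (thief (((d i : ℕ) + 1) % 2)) + 1) := by
  classical
  obtain ⟨a, ha⟩ := nk_cuts w (fun i => if d i = 0 then 1 else -1)
    (fun i => by split_ifs <;> simp)
  set f : ℕ → ℕ := fun p => (Finset.univ.filter (fun j : Fin n => a j ≤ p)).card with hf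
  have hmono : Monotone f := by
    intro x y hxy
    apply Finset.card_le_card
    intro j hj
    simp only [Finset.mem_filter] at hj ⊢
    exact ⟨hj.1, hj.2.trans hxy⟩
  have hfn : ∀ p, f p ≤ n := fun p => by
    have := Finset.card_le_univ (Finset.univ.filter (fun j : Fin n => a j ≤ p))
    simpa using this
  have hprod : ∀ p : ℕ, ∏ j, nkR (a j) p = (-1) ^ f p := by
    intro p
    have : ∀ j, nkR (a j) p = if a j ≤ p then -1 else 1 := by
      intro j; unfold nkR; split_ifs <;> first | rfl | omega
    simp only [this, Finset.prod_ite, Finset.prod_const, one_pow, mul_one, hf]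
  refine ⟨fun j => ((Finset.range m).filter (fun x => f x < (j : ℕ))).card, ?_, ?_, ?_, ?_⟩
  · intro x y hxy
    apply Finset.card_le_card
    intro p hp
    simp only [Finset.mem_filter] at hp ⊢
    exact ⟨hp.1, lt_of_lt_of_le hp.2 hxy⟩
  · simp
  · dsimp only
    rw [Finset.filter_true_of_mem, Finset.card_range]
    intro p _
    have := hfn p
    simp only [Fin.val_last]; omega
  · intro i thief hth
    have hth' : ∀ t, thief t = Finset.univ.filter (fun p : Fin m => f p % 2 = t) := by
      intro t
      rw [hth]
      ext p
      simp only [Finset.mem_filter, Finset.mem_univ, true_and]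
      constructor
      · rintro ⟨j, h1, h2, h3⟩
        rw [nk_initial f hmono m _ p p.2] at h2
        rw [← not_lt, nk_initial f hmono m _ p p.2] at h1
        simp only [Fin.val_castSucc, Fin.val_succ] at h1 h2
        have : f p = j := by omega
        rw [this, h3]
      · intro h
        have := hfn p
        refine ⟨⟨f p, by omega⟩, ?_, ?_, h⟩
        · rw [← not_lt, nk_initial f hmono m _ p p.2]; simp
        · rw [nk_initial f hmono m _ p p.2]; simp
    have hdiff : amt w i (thief 0) - amt w i (thief 1) =
        ∑ p : Fin m, (if w p = (i, true) then 1 else if w p = (i, false) then -1 else 0) *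
          ∏ j, nkR (a j) p := by
      rw [hth', hth']
      unfold amt
      rw [Finset.sum_filter, Finset.sum_filter, ← Finset.sum_sub_distrib]
      refine Finset.sum_congr rfl fun p _ => ?_
      rw [hprod]
      rcases Nat.even_or_odd (f p) with h | h
      · simp [h.neg_one_pow, Nat.even_iff.1 h]
      · simp [h.neg_one_pow, Nat.odd_iff.1 h]
    obtain ⟨h1, h2⟩ := ha i
    rw [← hdiff] at h1 h2
    refine ⟨fun h => by have := h1 h; omega, fun h => ?_⟩
    have h3 := h2 h
    rcases Fin.exists_fin_two.1 ⟨d i, rfl⟩ with hd | hd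
    · rw [hd] at h3 ⊢
      simp at h3 ⊢
      omega
    · rw [hd] at h3 ⊢
      simp at h3 ⊢
      omega
end

section
/- Decomposition lemma: let n ≥ 1 and let (s_1, ..., s_n) be a tuple of nonempty words over Σ_n, each of length at least 2, such that s_1···s_n ∈ O_n and the tuple is irreducible (no two compatible letters α, ᾱ occur among the 2n endpoints, i.e., first and last letters, of the s_j's). Then there exist words u_1, ..., u_{2n} over Σ_n and integers 0 = k_0 ≤ k_1 ≤ ... ≤ k_n = 2n such that s_j = u_{k_{j-1}+1} u_{k_{j-1}+2} ··· u_{k_j} for each j ∈ [n], and both u_1 u_3 ··· u_{2n-1} and u_2 u_4 ··· u_{2n} are nonempty elements of O_n. -/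
/-- `w ∈ O_n`: the letter `(i, true)` is `a_i` and `(i, false)` is `ā_i`;
`w` has equally many `a_i` and `ā_i` for each `i`. -/
def InO (n : ℕ) (w : List (Fin n × Bool)) : Prop :=
  ∀ i : Fin n, w.count (i, true) = w.count (i, false)

/-- weighted deletion operator on mod 2 cochains -/
def io {V : Type*} (f : V → ZMod 2) : List V → (List V → ZMod 2) → ZMod 2
  | [], _ => 0
  | v :: σ, g => f v * g σ + io f σ (fun ρ => g (v :: ρ))

/-- prism operator -/
def KK {V : Type*} (a b : V → V) : List V → (List V → ZMod 2) → ZMod 2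
  | [], _ => 0
  | v :: σ, g => g (a v :: b v :: σ.map b) + KK a b σ (fun ρ => g (a v :: ρ))

/-- iterated prism operator -/
def HH {V : Type*} (P : ℕ → V → V) (L : ℕ) (σ : List V) (g : List V → ZMod 2) : ZMod 2 :=
  ∑ q ∈ Finset.range L, KK (P q) (P (q + 1)) σ g

/-- evaluation on the `k`-dimensional hemisphere -/
def EE {V : Type*} (P : ℕ → V → V) (L : ℕ) (t : V → V) (c : V) : ℕ → (List V → ZMod 2) → ZMod 2
  | 0, g => g [c]
  | k + 1, g => EE P L t c k (fun σ => HH P L σ g + HH P L (σ.map t) g)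

theorem z2_self (x : ZMod 2) : x + x = 0 := CharTwo.add_self_eq_zero x

section
variable {V : Type*}

theorem io_add_right (f : V → ZMod 2) (σ : List V) (g h : List V → ZMod 2) :
    io f σ (fun ρ => g ρ + h ρ) = io f σ g + io f σ h := by
  induction σ generalizing g h with
  | nil => simp [io]
  | cons v σ ih => simp only [io, ih]; ring

theorem io_mul_right (f : V → ZMod 2) (σ : List V) (x : ZMod 2) (g : List V → ZMod 2) :
    io f σ (fun ρ => x * g ρ) = x * io f σ g := by
  induction σ generalizing g with
  | nil => simp [io]
  | cons v σ ih => simp only [io, ih]; ring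

theorem io_add_left (f f' : V → ZMod 2) (σ : List V) (g : List V → ZMod 2) :
    io (fun v => f v + f' v) σ g = io f σ g + io f' σ g := by
  induction σ generalizing g with
  | nil => simp [io]
  | cons v σ ih => simp only [io, ih]; ring

theorem io_sq (f : V → ZMod 2) (σ : List V) (g : List V → ZMod 2) :
    io f σ (fun ρ => io f ρ g) = 0 := by
  induction σ generalizing g with
  | nil => simp [io]
  | cons v σ ih =>
    simp only [io]
    rw [io_add_right, io_mul_right, ih, ← add_assoc, z2_self, add_zero]

theorem io_comm (f f' : V → ZMod 2) (σ : List V) (g : List V → ZMod 2) :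
    io f σ (fun ρ => io f' ρ g) = io f' σ (fun ρ => io f ρ g) := by
  have h := io_sq (fun v => f v + f' v) σ g
  simp only [io_add_left, io_add_right, io_sq] at h
  rw [zero_add, add_zero] at h
  exact (CharTwo.add_eq_zero.mp h).symm

theorem io_congr (f : V → ZMod 2) (σ : List V) (g h : List V → ZMod 2)
    (H : ∀ ρ, ρ ⊆ σ → g ρ = h ρ) : io f σ g = io f σ h := by
  induction σ generalizing g h with
  | nil => simp [io]
  | cons v σ ih =>
    simp only [io]
    rw [H σ (by simp), ih (fun ρ => g (v :: ρ)) (fun ρ => h (v :: ρ))]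
    intro ρ hρ
    exact H _ (List.cons_subset_cons v hρ)

theorem io_zero (f : V → ZMod 2) (σ : List V) (g : List V → ZMod 2)
    (H : ∀ v ∈ σ, f v = 0) : io f σ g = 0 := by
  induction σ generalizing g with
  | nil => simp [io]
  | cons v σ ih =>
    simp only [io]
    rw [H v (by simp), ih _ (fun w hw => H w (by simp [hw]))]; simp

theorem io_map (f : V → ZMod 2) (t : V → V) (σ : List V) (g : List V → ZMod 2) :
    io f (σ.map t) g = io (fun v => f (t v)) σ (fun ρ => g (ρ.map t)) := by
  induction σ generalizing g with
  | nil => simp [io]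
  | cons v σ ih => simp [io, ih]

theorem KK_add (a b : V → V) (σ : List V) (g h : List V → ZMod 2) :
    KK a b σ (fun ρ => g ρ + h ρ) = KK a b σ g + KK a b σ h := by
  induction σ generalizing g h with
  | nil => simp [KK]
  | cons v σ ih => simp only [KK, ih]; ring

theorem KK_zero (a b : V → V) (σ : List V) (g : List V → ZMod 2)
    (H : ∀ ρ : List V, (∀ x ∈ ρ, ∃ v ∈ σ, x = a v ∨ x = b v) → g ρ = 0) :
    KK a b σ g = 0 := by
  induction σ generalizing g with
  | nil => simp [KK]
  | cons v σ ih =>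
    simp only [KK]
    rw [H, ih, add_zero]
    · intro ρ hρ
      apply H
      intro x hx
      rcases List.mem_cons.mp hx with rfl | hx
      · exact ⟨v, by simp, Or.inl rfl⟩
      · obtain ⟨w, hw, h⟩ := hρ x hx
        exact ⟨w, by simp [hw], h⟩
    · intro x hx
      simp only [List.mem_cons, List.mem_map] at hx
      rcases hx with rfl | rfl | ⟨w, hw, rfl⟩
      · exact ⟨v, by simp, Or.inl rfl⟩
      · exact ⟨v, by simp, Or.inr rfl⟩
      · exact ⟨w, by simp [hw], Or.inr rfl⟩

/-- the boundary -/
abbrev dl (σ : List V) (g : List V → ZMod 2) : ZMod 2 := io (fun _ => 1) σ g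

theorem KK_homotopy (a b : V → V) (σ : List V) (g : List V → ZMod 2) :
    KK a b σ (fun ρ => dl ρ g) + dl σ (fun ρ => KK a b ρ g) = g (σ.map a) + g (σ.map b) := by
  induction σ generalizing g with
  | nil => simp [KK, dl, io, z2_self]
  | cons v σ ih =>
    have := ih (fun ρ => g (a v :: ρ))
    simp only [dl, KK, io, one_mul, List.map_cons] at this ⊢
    rw [KK_add, io_add_right, io_map]
    have e1 := z2_self (KK a b σ g)
    have e2 := z2_self (io (fun _ => 1) σ (fun ρ => g (a v :: b v :: ρ.map b)))
    have e3 := z2_self (g (a v :: σ.map b))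
    linear_combination this + e1 + e2 + e3

theorem dl_sum (σ : List V) {ι : Type*} (s : Finset ι) (G : ι → List V → ZMod 2) :
    io (fun _ => 1) σ (fun ρ => ∑ q ∈ s, G q ρ) = ∑ q ∈ s, io (fun _ => 1) σ (G q) := by
  classical
  induction s using Finset.induction_on with
  | empty =>
    simp only [Finset.sum_empty]
    have := io_mul_right (fun _ => (1 : ZMod 2)) σ 0 (fun _ => 0)
    simpa using this
  | insert i s hi ih => simp only [Finset.sum_insert hi, io_add_right, ih]

theorem HH_homotopy (P : ℕ → V → V) (L : ℕ) (σ : List V) (g : List V → ZMod 2) :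
    HH P L σ (fun ρ => dl ρ g) + dl σ (fun ρ => HH P L ρ g)
      = g (σ.map (P 0)) + g (σ.map (P L)) := by
  unfold HH
  rw [dl, dl_sum, ← Finset.sum_add_distrib]
  simp only [KK_homotopy]
  induction L with
  | zero => simp [z2_self]
  | succ L ih =>
    rw [Finset.sum_range_succ, ih]
    linear_combination z2_self (g (σ.map (P L)))

theorem HH_add (P : ℕ → V → V) (L : ℕ) (σ : List V) (g h : List V → ZMod 2) :
    HH P L σ (fun ρ => g ρ + h ρ) = HH P L σ g + HH P L σ h := by
  simp only [HH, KK_add, Finset.sum_add_distrib]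

theorem EE_add (P : ℕ → V → V) (L : ℕ) (t : V → V) (c : V) (k : ℕ) (g h : List V → ZMod 2) :
    EE P L t c k (fun ρ => g ρ + h ρ) = EE P L t c k g + EE P L t c k h := by
  induction k generalizing g h with
  | zero => simp [EE]
  | succ k ih =>
    simp only [EE, HH_add]
    rw [← ih]
    congr 1; funext σ; ring

theorem EE_bd (P : ℕ → V → V) (L : ℕ) (t : V → V) (c c0 : V) (ht : ∀ v, t (t v) = v)
    (hP0 : ∀ v, P 0 v = c0) (hPL : ∀ v, P L v = v) (k : ℕ) (g : List V → ZMod 2) :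
    EE P L t c (k + 1) (fun ρ => dl ρ g) = EE P L t c k (fun σ => g σ + g (σ.map t)) := by
  have tt : ∀ σ : List V, (σ.map t).map t = σ := by
    intro σ
    rw [List.map_map]
    exact List.map_id'' (fun v => ht v) σ
  have key : ∀ σ, HH P L σ (fun ρ => dl ρ g) + HH P L (σ.map t) (fun ρ => dl ρ g)
      = (g σ + g (σ.map t)) + dl σ (fun ρ => HH P L ρ g + HH P L (ρ.map t) g) := by
    intro σ
    have h1 := HH_homotopy P L σ g
    have h2 := HH_homotopy P L (σ.map t) g
    have e1 : (σ.map t).map (P 0) = σ.map (P 0) := by simp [hP0]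
    have e2 : ∀ σ : List V, σ.map (P L) = σ := by
      intro σ
      exact List.map_id'' hPL σ
    rw [e1, e2] at h2
    rw [e2] at h1
    rw [dl, io_add_right]
    rw [dl, io_map] at h2
    have e3 := z2_self (g (σ.map (P 0)))
    have e4 := z2_self (io (fun _ => 1) σ (fun ρ => HH P L ρ g))
    have e5 := z2_self (io (fun _ => 1) σ (fun ρ => HH P L (ρ.map t) g))
    linear_combination h1 + h2 + e3 - e4 - e5
  show EE P L t c k _ = _
  simp only [key]
  rw [EE_add]
  suffices h : EE P L t c k (fun σ => dl σ (fun ρ => HH P L ρ g + HH P L (ρ.map t) g)) = 0 by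
    rw [h, add_zero]
  cases k with
  | zero => simp [EE, dl, io, HH, KK]
  | succ k =>
    rw [EE_bd P L t c c0 ht hP0 hPL k]
    simp only [tt]
    have : (fun σ => HH P L σ g + HH P L (σ.map t) g + (HH P L (σ.map t) g + HH P L σ g))
      = (fun σ => (HH P L σ g + HH P L (σ.map t) g) + (HH P L σ g + HH P L (σ.map t) g)) := by
      funext σ; ring
    rw [this, EE_add, z2_self]

theorem EE_zero (P : ℕ → V → V) (L : ℕ) (t : V → V) (c : V) (C : ℕ → List V → Prop)
    (h0 : C 0 [c])
    (hC : ∀ k σ q ρ, C k σ → (∀ x ∈ ρ, ∃ v ∈ σ, x = P q v ∨ x = P (q + 1) v) → C (k + 1) ρ)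
    (ht : ∀ k σ, C k σ → C k (σ.map t)) (k : ℕ) (g : List V → ZMod 2)
    (hg : ∀ σ, C k σ → g σ = 0) : EE P L t c k g = 0 := by
  induction k generalizing g with
  | zero => exact hg _ h0
  | succ k ih =>
    apply ih
    have : ∀ σ, C k σ → HH P L σ g = 0 := by
      intro σ hσ
      apply Finset.sum_eq_zero
      intro q _
      apply KK_zero
      intro ρ hρ
      exact hg _ (hC k σ q ρ hσ hρ)
    intro σ hσ
    rw [this σ hσ, this _ (ht k σ hσ), add_zero]

/-- label indicator -/
def fl {I : Type*} [DecidableEq I] (lam : V → I × Bool) (i : I) (s : Bool) (v : V) : ZMod 2 :=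
  if lam v = (i, s) then 1 else 0

/-- alternating cochains -/
def AA {I : Type*} [DecidableEq I] (lam : V → I × Bool) :
    List I → ℕ → Bool → List V → ZMod 2
  | _, 0, _, _ => 1
  | [], _ + 1, _, _ => 0
  | i :: l, r + 1, s, σ => AA lam l (r + 1) s σ + io (fl lam i s) σ (AA lam l r (!s))

/-- sum of label indicators -/
def SS {I : Type*} [DecidableEq I] (lam : V → I × Bool) : List I → V → ZMod 2
  | [], _ => 0
  | i :: l, v => SS lam l v + (fl lam i true v + fl lam i false v)

variable {I : Type*} [DecidableEq I] (lam : V → I × Bool)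

theorem AA_zero (l : List I) (s : Bool) (σ : List V) : AA lam l 0 s σ = 1 := by
  cases l <;> simp [AA]

theorem AA_big (l : List I) (r : ℕ) (s : Bool) (σ : List V) (h : l.length < r) :
    AA lam l r s σ = 0 := by
  induction l generalizing r s σ with
  | nil => cases r <;> simp_all [AA]
  | cons i l ih =>
    cases r with
    | zero => simp at h
    | succ r =>
      simp only [List.length_cons] at h
      simp only [AA]
      rw [ih _ _ _ (by omega), io_congr _ _ _ (fun _ => 0 * 0) (fun ρ _ => by
        rw [ih _ _ _ (by omega)]; simp), io_mul_right]
      simp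

theorem AA_id (l : List I) (r : ℕ) (s : Bool) (σ : List V)
    (hσ : ∀ v ∈ σ, ∀ w ∈ σ, lam w ≠ ((lam v).1, !(lam v).2)) :
    io (SS lam l) σ (AA lam l r s) = AA lam l (r + 1) true σ + AA lam l (r + 1) false σ := by
  induction l generalizing r s σ with
  | nil =>
    rw [io_zero]
    · simp [AA]
    · simp [SS]
  | cons i l ih =>
    have hS : SS lam (i :: l) = fun v => SS lam l v + (fl lam i true v + fl lam i false v) := by
      funext v; simp [SS]
    rw [hS, io_add_left, io_add_left]
    cases r with
    | zero =>
      have e : ∀ (l : List I) s, AA lam l 0 s = fun _ => 1 := by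
        intro l s; funext σ; exact AA_zero lam l s σ
      have := ih 0 s σ hσ
      simp only [AA]
      simp only [e] at this ⊢
      rw [this]
      ring
    | succ r =>
      have hA : AA lam (i :: l) (r + 1) s =
          fun σ => AA lam l (r + 1) s σ + io (fl lam i s) σ (AA lam l r (!s)) := by
        funext σ; simp [AA]
      rw [hA]
      simp only [io_add_right]
      rw [ih _ _ _ hσ, io_comm (SS lam l),
        io_congr (fl lam i s) σ _ (fun ρ => AA lam l (r + 1) true ρ + AA lam l (r + 1) false ρ)
        (fun ρ hρ => ih _ _ _ (fun v hv w hw => hσ v (hρ hv) w (hρ hw))), io_add_right]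
      have hz : io (fl lam i (!s)) σ (fun ρ => io (fl lam i s) ρ (AA lam l r (!s))) = 0 := by
        by_cases h : ∃ v ∈ σ, lam v = (i, s)
        · obtain ⟨v, hv, hvs⟩ := h
          apply io_zero
          intro w hw
          have := hσ v hv w hw
          rw [hvs] at this
          simp only [fl]
          rw [if_neg this]
        · rw [io_comm]
          apply io_zero
          intro w hw
          simp only [fl]
          rw [if_neg]
          intro h'
          exact h ⟨w, hw, h'⟩
      have hz2 := io_sq (fl lam i s) σ (AA lam l r (!s))
      have e1 := z2_self (io (fl lam i s) σ (AA lam l (r + 1) s))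
      simp only [AA]
      cases s
      · simp only [Bool.not_false, Bool.not_true] at *
        linear_combination hz + hz2 + e1
      · simp only [Bool.not_false, Bool.not_true] at *
        linear_combination hz + hz2 + e1

theorem AA_map (t : V → V) (ht : ∀ v, lam (t v) = ((lam v).1, !(lam v).2))
    (l : List I) (r : ℕ) (s : Bool) (σ : List V) :
    AA lam l r s (σ.map t) = AA lam l r (!s) σ := by
  induction l generalizing r s σ with
  | nil => cases r <;> simp [AA]
  | cons i l ih =>
    cases r with
    | zero => simp [AA]
    | succ r =>
      simp only [AA]
      rw [ih, io_map]
      have : (fun v => fl lam i s (t v)) = fl lam i (!s) := by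
        funext v
        simp only [fl, ht]
        congr 1
        rw [Prod.ext_iff, Prod.ext_iff]
        cases s <;> simp
      rw [this]
      simp only [ih]

theorem SS_finRange {n : ℕ} (lam : V → Fin n × Bool) (v : V) :
    SS lam (List.finRange n) v = 1 := by
  have key : ∀ l : List (Fin n), l.Nodup → SS lam l v = if (lam v).1 ∈ l then 1 else 0 := by
    intro l hl
    induction l with
    | nil => simp [SS]
    | cons i l ih =>
      rw [List.nodup_cons] at hl
      simp only [SS]
      rw [ih hl.2]
      have : fl lam i true v + fl lam i false v = if (lam v).1 = i then 1 else 0 := by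
        simp only [fl, Prod.ext_iff]
        cases (lam v).2 <;> simp
      rw [this]
      by_cases h : (lam v).1 = i
      · subst h; simp [hl.1]
      · simp [h]
  rw [key _ (List.nodup_finRange n)]
  simp

theorem tucker_abs {n : ℕ} (lam : V → Fin n × Bool) (P : ℕ → V → V) (L : ℕ) (t : V → V) (c c0 : V)
    (ht : ∀ v, t (t v) = v) (hP0 : ∀ v, P 0 v = c0) (hPL : ∀ v, P L v = v)
    (hlam : ∀ v, lam (t v) = ((lam v).1, !(lam v).2))
    (C : ℕ → List V → Prop)
    (h0 : C 0 [c])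
    (hC : ∀ k σ q ρ, C k σ → (∀ x ∈ ρ, ∃ v ∈ σ, x = P q v ∨ x = P (q + 1) v) → C (k + 1) ρ)
    (hCt : ∀ k σ, C k σ → C k (σ.map t))
    (hgood : ∀ k σ, k ≤ n → C k σ → ∀ v ∈ σ, ∀ w ∈ σ, lam w ≠ ((lam v).1, !(lam v).2)) :
    False := by
  set l := List.finRange n
  have hS : SS lam l = fun _ => 1 := by funext v; exact SS_finRange lam v
  have main : ∀ k, k ≤ n → EE P L t c k
      (fun σ => AA lam l (k + 1) true σ + AA lam l (k + 1) false σ) = 1 := by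
    intro k
    induction k with
    | zero =>
      intro _
      simp only [EE]
      rw [← AA_id lam l 0 true [c] (hgood 0 _ (by omega) h0), hS]
      simp [io, AA_zero]
    | succ k ih =>
      intro hk
      have h1 := EE_bd P L t c c0 ht hP0 hPL k (AA lam l (k + 1) true)
      simp only [AA_map lam t hlam, Bool.not_true] at h1
      rw [ih (by omega)] at h1
      have h2 := EE_zero P L t c C h0 hC hCt (k + 1)
        (fun σ => (AA lam l (k + 2) true σ + AA lam l (k + 2) false σ)
          + dl σ (AA lam l (k + 1) true)) (by
          intro σ hσ
          rw [← AA_id lam l (k + 1) true σ (hgood _ _ hk hσ), hS]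
          exact z2_self _)
      rw [EE_add, h1] at h2
      exact CharTwo.add_eq_zero.mp h2
  have := main n le_rfl
  have hz : ∀ s σ, AA lam l (n + 1) s σ = 0 := fun s σ => AA_big lam l _ _ _ (by simp [l])
  simp only [hz, add_zero] at this
  have h2 := EE_add P L t c n (fun _ => 0) (fun _ => 0)
  simp only [add_zero, this] at h2
  exact absurd h2 (by decide)

end

/-- `y` has at most `n` sign changes -/
def Alt {L : ℕ} (n : ℕ) (y : Fin L → Bool) : Prop :=
  ∃ (c : Fin L → ℕ) (b : Bool), Monotone c ∧ (∀ q, c q ≤ n) ∧ ∀ q, y q = (b ^^ decide (c q % 2 = 1))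

theorem Alt.neg {L n : ℕ} {y : Fin L → Bool} (h : Alt n y) : Alt n (fun q => !y q) := by
  obtain ⟨c, b, h1, h2, h3⟩ := h
  refine ⟨c, !b, h1, h2, fun q => ?_⟩
  simp [h3]

/-- truncation -/
def PP {L : ℕ} (q : ℕ) (y : Fin L → Bool) : Fin L → Bool := fun r => if r.val < q then y r else true

theorem Alt.PP {L n : ℕ} {y : Fin L → Bool} (h : Alt n y) (q : ℕ) : Alt (n + 1) (PP q y) := by
  obtain ⟨c, b, h1, h2, h3⟩ := h
  obtain ⟨m, hm1, hm2, hm3⟩ : ∃ m, n ≤ m ∧ m ≤ n + 1 ∧ true = (b ^^ decide (m % 2 = 1)) := by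
    rcases Nat.mod_two_eq_zero_or_one n with h | h <;> cases b
    · exact ⟨n + 1, by omega, by omega, by simp; omega⟩
    · exact ⟨n, by omega, by omega, by simp; omega⟩
    · exact ⟨n, by omega, by omega, by simp; omega⟩
    · exact ⟨n + 1, by omega, by omega, by simp; omega⟩
  refine ⟨fun r => if r.val < q then c r else m, b, ?_, ?_, ?_⟩
  · intro r r' hr
    have : r.val ≤ r'.val := hr
    have := h1 hr
    have := h2 r
    dsimp only
    split_ifs <;> omega
  · intro r
    have := h2 r
    dsimp only
    split_ifs <;> omega
  · intro r
    simp only [_root_.PP]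
    split_ifs
    · exact h3 r
    · exact hm3

theorem tucker {n L : ℕ} (lam : (Fin L → Bool) → Fin n × Bool)
    (hodd : ∀ y, lam (fun q => !y q) = ((lam y).1, !(lam y).2)) :
    ∃ y y', Alt n y ∧ Alt n y' ∧ hammingDist y y' ≤ n ∧
      lam y' = ((lam y).1, !(lam y).2) := by
  by_contra hcon
  push Not at hcon
  have altmono : ∀ {k : ℕ} {y : Fin L → Bool}, k ≤ n → Alt k y → Alt n y := by
    rintro k y hk ⟨c, b, h1, h2, h3⟩
    exact ⟨c, b, h1, fun q => (h2 q).trans hk, h3⟩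
  have ham : ∀ (q a b : ℕ) (v w : Fin L → Bool), (a = q ∨ a = q + 1) → (b = q ∨ b = q + 1) →
      hammingDist (PP a v) (PP b w) ≤ hammingDist v w + 1 := by
    intro q a b v w ha hb
    unfold hammingDist
    have : (Finset.univ.filter fun i : Fin L => i.val = q).card ≤ 1 := by
      rw [Finset.card_le_one]
      intro i hi j hj
      simp at hi hj
      ext; omega
    refine le_trans ?_ (Nat.add_le_add_left this _)
    refine le_trans (Finset.card_le_card ?_) (Finset.card_union_le _ _)
    intro i
    simp only [Finset.mem_filter, Finset.mem_univ, true_and, Finset.mem_union, PP]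
    intro h
    by_contra hc
    push Not at hc
    have h := (Finset.mem_filter.mp h).2
    apply h
    rw [hc.1]
    split_ifs <;> first | rfl | omega
  refine tucker_abs lam PP L (fun y q => !y q) (fun _ => true) (fun _ => true) ?_ ?_ ?_ hodd
    (fun k σ => (∀ v ∈ σ, Alt k v) ∧ ∀ v ∈ σ, ∀ w ∈ σ, hammingDist v w ≤ k) ?_ ?_ ?_ ?_
  · intro v; funext q; exact Bool.not_not _
  · intro v; funext r; simp [PP]
  · intro v; funext r; simp [PP]
  · simp
    exact ⟨fun _ => 0, true, monotone_const, by simp, by simp⟩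
  · rintro k σ q ρ ⟨h1, h2⟩ hρ
    constructor
    · intro x hx
      obtain ⟨v, hv, rfl | rfl⟩ := hρ x hx <;> exact (h1 v hv).PP _
    · intro x hx x' hx'
      obtain ⟨v, hv, e⟩ := hρ x hx
      obtain ⟨w, hw, e'⟩ := hρ x' hx'
      have := h2 v hv w hw
      rcases e with rfl | rfl <;> rcases e' with rfl | rfl <;>
        exact (ham q _ _ v w (by simp) (by simp)).trans (by omega)
  · rintro k σ ⟨h1, h2⟩
    constructor
    · intro x hx
      obtain ⟨v, hv, rfl⟩ := List.mem_map.mp hx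
      exact (h1 v hv).neg
    · intro x hx x' hx'
      obtain ⟨v, hv, rfl⟩ := List.mem_map.mp hx
      obtain ⟨w, hw, rfl⟩ := List.mem_map.mp hx'
      refine le_trans (le_of_eq ?_) (h2 v hv w hw)
      simp [hammingDist]
  · rintro k σ hk ⟨h1, h2⟩ v hv w hw
    exact hcon v w (altmono hk (h1 v hv)) (altmono hk (h1 w hw)) ((h2 v hv w hw).trans hk)

/-- sign of a Boolean -/
def sgb (b : Bool) : ℤ := if b then 1 else -1

theorem sgb_not (b : Bool) : sgb (!b) = - sgb b := by cases b <;> simp [sgb]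

theorem round_aux {α : Type*} (S : Finset α) (lo hi : α → ℤ)
    (hl : ∀ p, lo p = 1 ∨ lo p = -1) (hh : ∀ p, hi p = 1 ∨ hi p = -1) (hlh : ∀ p, lo p ≤ hi p)
    (t : ℤ) (h1 : ∑ p ∈ S, lo p ≤ t) (h2 : t ≤ ∑ p ∈ S, hi p)
    (h3 : (2 : ℤ) ∣ t - ∑ p ∈ S, lo p) :
    ∃ r : α → ℤ, (∀ p, r p = lo p ∨ r p = hi p) ∧ ∑ p ∈ S, r p = t := by
  classical
  induction S using Finset.induction_on generalizing t with
  | empty => exact ⟨lo, fun p => Or.inl rfl, by simp at *; omega⟩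
  | insert a S ha ih =>
    rw [Finset.sum_insert ha] at h1 h2 h3
    have hS : ∑ p ∈ S, lo p ≤ ∑ p ∈ S, hi p := Finset.sum_le_sum fun p _ => hlh p
    have hla := hl a
    have hha := hh a
    have hlha := hlh a
    obtain ⟨x, hx, hx1, hx2, hx3⟩ : ∃ x, (x = lo a ∨ x = hi a) ∧ ∑ p ∈ S, lo p ≤ t - x ∧
        t - x ≤ ∑ p ∈ S, hi p ∧ (2 : ℤ) ∣ (t - x) - ∑ p ∈ S, lo p := by
      by_cases h : ∑ p ∈ S, lo p ≤ t - hi a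
      · exact ⟨hi a, Or.inr rfl, h, by omega, by omega⟩
      · exact ⟨lo a, Or.inl rfl, by omega, by omega, by omega⟩
    obtain ⟨r, hr1, hr2⟩ := ih (t - x) hx1 hx2 hx3
    refine ⟨Function.update r a x, ?_, ?_⟩
    · intro p
      by_cases hp : p = a
      · subst hp; simpa using hx
      · simpa [hp] using hr1 p
    · rw [Finset.sum_insert ha]
      have : ∑ p ∈ S, Function.update r a x p = ∑ p ∈ S, r p := by
        apply Finset.sum_congr rfl
        intro p hp
        have : p ≠ a := by rintro rfl; exact ha hp
        simp [this]
      rw [this, hr2]; simp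

/-- the linear functional -/
def FF {n N M : ℕ} (typ : Fin N → Fin n) (ep : Fin N → ℤ) (i : Fin n)
    (y : Fin (N * M) → Bool) : ℤ :=
  ∑ q, if typ (finProdFinEquiv.symm q).1 = i then ep (finProdFinEquiv.symm q).1 * sgb (y q) else 0

theorem FF_eq {n N M : ℕ} (typ : Fin N → Fin n) (ep : Fin N → ℤ) (i : Fin n)
    (y : Fin (N * M) → Bool) :
    FF typ ep i y = ∑ p : Fin N, ∑ b : Fin M,
      if typ p = i then ep p * sgb (y (finProdFinEquiv (p, b))) else 0 := by
  unfold FF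
  rw [← Equiv.sum_comp finProdFinEquiv, Fintype.sum_prod_type]
  simp only [Equiv.symm_apply_apply]

theorem FF_neg {n N M : ℕ} (typ : Fin N → Fin n) (ep : Fin N → ℤ) (i : Fin n)
    (y : Fin (N * M) → Bool) : FF typ ep i (fun q => !y q) = - FF typ ep i y := by
  unfold FF
  rw [← Finset.sum_neg_distrib]
  apply Finset.sum_congr rfl
  intro q _
  rw [sgb_not]
  split_ifs <;> ring

theorem FF_lip {n N M : ℕ} (typ : Fin N → Fin n) (ep : Fin N → ℤ)
    (hep : ∀ p, ep p = 1 ∨ ep p = -1) (i : Fin n)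
    (y y' : Fin (N * M) → Bool) :
    |FF typ ep i y - FF typ ep i y'| ≤ 2 * hammingDist y y' := by
  unfold FF hammingDist
  rw [← Finset.sum_sub_distrib]
  refine (Finset.abs_sum_le_sum_abs _ _).trans ?_
  rw [Finset.card_filter]
  push_cast
  rw [Finset.mul_sum]
  apply Finset.sum_le_sum
  intro q _
  rcases hep (finProdFinEquiv.symm q).1 with h | h <;> rw [h] <;>
  cases y q <;> cases y' q <;> simp [sgb] <;> split_ifs <;> simp

theorem round_block {n N M : ℕ} (hM : 0 < M) (typ : Fin N → Fin n) (s ep : Fin N → ℤ)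
    (hs : ∀ p, s p = 1 ∨ s p = -1)
    (hep : ∀ p, ep p = 1 ∨ ep p = -1)
    (hbal : ∀ i, ∑ p, (if typ p = i then s p else 0) = 0)
    (y : Fin (N * M) → Bool) (hy : ∀ i, |FF typ ep i y| < M) :
    ∃ z : Fin N → Bool, (∀ p, ∃ b, y (finProdFinEquiv (p, b)) = z p) ∧
      ∀ i, ∑ p, (if typ p = i then ep p * sgb (z p) else 0) = 0 := by
  classical
  set b0 : Fin M := ⟨0, hM⟩
  have hpm : ∀ p c, ep p * sgb c = 1 ∨ ep p * sgb c = -1 := by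
    intro p c
    rcases hep p with h | h <;> cases c <;> simp [h, sgb]
  set lo : Fin N → ℤ := fun p =>
    if ∃ b, ep p * sgb (y (finProdFinEquiv (p, b))) = -1 then -1 else 1 with hlo
  set hi : Fin N → ℤ := fun p =>
    if ∃ b, ep p * sgb (y (finProdFinEquiv (p, b))) = 1 then 1 else -1 with hhi
  have lo1 : ∀ p b, lo p ≤ ep p * sgb (y (finProdFinEquiv (p, b))) := by
    intro p b
    simp only [hlo]
    rcases hpm p (y (finProdFinEquiv (p, b))) with h | h
    · rw [h]; split_ifs <;> simp
    · rw [if_pos ⟨b, h⟩, h]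
  have hi1 : ∀ p b, ep p * sgb (y (finProdFinEquiv (p, b))) ≤ hi p := by
    intro p b
    simp only [hhi]
    rcases hpm p (y (finProdFinEquiv (p, b))) with h | h
    · rw [if_pos ⟨b, h⟩, h]
    · rw [h]; split_ifs <;> simp
  have lo2 : ∀ p, ∃ b, ep p * sgb (y (finProdFinEquiv (p, b))) = lo p := by
    intro p
    simp only [hlo]
    split_ifs with h
    · exact h
    · push Not at h
      exact ⟨b0, (hpm p _).resolve_right (h b0)⟩
  have hi2 : ∀ p, ∃ b, ep p * sgb (y (finProdFinEquiv (p, b))) = hi p := by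
    intro p
    simp only [hhi]
    split_ifs with h
    · exact h
    · push Not at h
      exact ⟨b0, (hpm p _).resolve_left (h b0)⟩
  have lopm : ∀ p, lo p = 1 ∨ lo p = -1 := by
    intro p; simp only [hlo]; split_ifs <;> simp
  have hipm : ∀ p, hi p = 1 ∨ hi p = -1 := by
    intro p; simp only [hhi]; split_ifs <;> simp
  have key : ∀ i : Fin n, ∃ r : Fin N → ℤ, (∀ p, r p = lo p ∨ r p = hi p) ∧
      ∑ p ∈ Finset.univ.filter (fun p => typ p = i), r p = 0 := by
    intro i
    have hyi := abs_lt.mp (hy i)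
    rw [FF_eq] at hyi
    have hMz : (0 : ℤ) < M := by exact_mod_cast hM
    apply round_aux _ lo hi lopm hipm (fun p => (lo1 p b0).trans (hi1 p b0))
    · have : (M : ℤ) * ∑ p ∈ Finset.univ.filter (fun p => typ p = i), lo p < M * 1 := by
        refine lt_of_le_of_lt ?_ (by simpa using hyi.2)
        rw [Finset.sum_filter, Finset.mul_sum]
        apply Finset.sum_le_sum
        intro p _
        split_ifs
        · have := Finset.card_nsmul_le_sum (Finset.univ : Finset (Fin M)) _ _ (fun b _ => lo1 p b)
          simpa using this
        · simp
      have := lt_of_mul_lt_mul_left this hMz.le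
      omega
    · have : (M : ℤ) * (-1) < M * ∑ p ∈ Finset.univ.filter (fun p => typ p = i), hi p := by
        refine lt_of_lt_of_le (by simpa using hyi.1) ?_
        rw [Finset.sum_filter, Finset.mul_sum]
        apply Finset.sum_le_sum
        intro p _
        split_ifs
        · have := Finset.sum_le_card_nsmul (Finset.univ : Finset (Fin M)) _ _ (fun b _ => hi1 p b)
          simpa using this
        · simp
      have := lt_of_mul_lt_mul_left this hMz.le
      omega
    · have h0 := hbal i
      rw [← Finset.sum_filter] at h0
      rw [← h0, ← Finset.sum_sub_distrib]
      apply Finset.dvd_sum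
      intro p _
      have := lopm p
      have := hs p
      omega
  choose r hr1 hr2 using key
  have hz : ∀ p, ∃ b, ep p * sgb (y (finProdFinEquiv (p, b))) = r (typ p) p := by
    intro p
    rcases hr1 (typ p) p with h | h <;> rw [h]
    · exact lo2 p
    · exact hi2 p
  choose b hb using hz
  refine ⟨fun p => y (finProdFinEquiv (p, b p)), fun p => ⟨b p, rfl⟩, fun i => ?_⟩
  rw [← Finset.sum_filter, ← hr2 i]
  apply Finset.sum_congr rfl
  intro p hp
  rw [hb p, (Finset.mem_filter.mp hp).2]

theorem alt_lt {L : ℕ} {y : Fin L → Bool} {c : Fin L → ℕ} {b : Bool} (hc : Monotone c)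
    (h : ∀ q, y q = (b ^^ decide (c q % 2 = 1))) {q q' : Fin L} (hq : q ≤ q') (hne : y q ≠ y q') :
    c q + 1 ≤ c q' := by
  have h1 := hc hq
  rcases Nat.lt_or_ge (c q) (c q') with h2 | h2
  · exact h2
  · have : c q = c q' := le_antisymm h1 h2
    rw [h q, h q', this] at hne
    exact absurd rfl hne

theorem fp_le {N M : ℕ} {p p' : Fin N} (b b' : Fin M) (h : p < p') :
    finProdFinEquiv (p, b) ≤ finProdFinEquiv (p', b') := by
  rw [Fin.le_def]
  simp only [finProdFinEquiv_apply_val]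
  have : p.val + 1 ≤ p'.val := h
  have h2 := Nat.mul_le_mul_left M this
  have := b.isLt
  rw [Nat.mul_add] at h2
  omega

/-- alternating block sign -/
def tau {N : ℕ} (jj : Fin N → ℕ) (p : Fin N) : Bool := decide (jj p % 2 = 0)

theorem star {n N M : ℕ} (hN : 0 < N) (jj : Fin N → ℕ)
    (hlast : jj ⟨N - 1, by omega⟩ = n - 1) (hzero : jj ⟨0, hN⟩ = 0)
    (hn : 1 ≤ n)
    (hstep : ∀ p q : Fin N, q.val = p.val + 1 → jj q = jj p ∨ jj q = jj p + 1)
    (y : Fin (N * M) → Bool) (hy : Alt n y)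
    (hst : ∀ p, ∃ b, y (finProdFinEquiv (p, b)) = tau jj p)
    (p : Fin N) (b : Fin M) (hpb : y (finProdFinEquiv (p, b)) ≠ tau jj p) :
    ¬ ∃ p0 p1 : Fin N, p0.val + 1 = p.val ∧ p.val + 1 = p1.val ∧ jj p0 = jj p ∧ jj p1 = jj p := by
  rintro ⟨p0, p1, h0, h1, e0, e1⟩
  choose a ha using hst
  obtain ⟨c, s, hc, hcn, hcy⟩ := hy
  set A : Fin N → ℕ := fun p => c (finProdFinEquiv (p, a p)) with hA
  have key : ∀ (m : ℕ) (u v : Fin N), v.val = u.val + m → A u + jj v ≤ A v + jj u := by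
    intro m
    induction m with
    | zero =>
      intro u v h
      have : u = v := Fin.ext (by omega)
      subst this; exact le_rfl
    | succ m ih =>
      intro u v h
      have hv := v.isLt
      set w : Fin N := ⟨u.val + m, by omega⟩ with hw
      have h1 := ih u w rfl
      have hwv : w < v := by rw [Fin.lt_def, h]; simp [w]
      have hle := fp_le (a w) (a v) hwv
      rcases hstep w v (by rw [h]; simp [w]; omega) with h2 | h2
      · have : A w ≤ A v := hc hle
        omega
      · have hne : y (finProdFinEquiv (w, a w)) ≠ y (finProdFinEquiv (v, a v)) := by
          rw [ha, ha]
          simp only [tau, h2, ne_eq, decide_eq_decide]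
          omega
        have : A w + 1 ≤ A v := alt_lt hc hcy hle hne
        omega
  have k1 := key p0.val ⟨0, hN⟩ p0 (by simp)
  have k2 := key (N - 1 - p1.val) p1 ⟨N - 1, by omega⟩ (by have := p1.isLt; simp; omega)
  have t0 : tau jj p0 = tau jj p := by simp [tau, e0]
  have t1 : tau jj p1 = tau jj p := by simp [tau, e1]
  have l1 : A p0 + 1 ≤ c (finProdFinEquiv (p, b)) :=
    alt_lt hc hcy (fp_le _ _ (by rw [Fin.lt_def]; omega)) (by rw [ha, t0]; exact hpb.symm)
  have l2 : c (finProdFinEquiv (p, b)) + 1 ≤ A p1 :=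
    alt_lt hc hcy (fp_le _ _ (by rw [Fin.lt_def]; omega)) (by rw [ha, t1]; exact hpb)
  have l3 : A ⟨N - 1, by omega⟩ ≤ n := hcn _
  rw [hlast] at k2
  rw [hzero] at k1
  omega

theorem core {n N : ℕ} (hn : 1 ≤ n) (hN : 0 < N) (jj : Fin N → ℕ)
    (hlast : jj ⟨N - 1, by omega⟩ = n - 1) (hzero : jj ⟨0, hN⟩ = 0)
    (hstep : ∀ p q : Fin N, q.val = p.val + 1 → jj q = jj p ∨ jj q = jj p + 1)
    (typ : Fin N → Fin n) (s : Fin N → ℤ) (hs : ∀ p, s p = 1 ∨ s p = -1)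
    (hbal : ∀ i, ∑ p, (if typ p = i then s p else 0) = 0)
    (hend : ∀ p, (¬ ∃ p0 p1 : Fin N, p0.val + 1 = p.val ∧ p.val + 1 = p1.val ∧
      jj p0 = jj p ∧ jj p1 = jj p) → s p = 1) :
    ∃ z : Fin N → Bool, Alt n z ∧
      (∀ i, ∑ p, (if typ p = i then (s p * sgb (tau jj p)) * sgb (z p) else 0) = 0) ∧
      (∃ p, z p ≠ tau jj p) ∧ (∃ p, z p = tau jj p) := by
  classical
  set M := n * n + n + 1 with hM
  have hMpos : 0 < M := by omega
  set ep : Fin N → ℤ := fun p => s p * sgb (tau jj p) with hepdef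
  have hep : ∀ p, ep p = 1 ∨ ep p = -1 := by
    intro p
    simp only [hepdef]
    rcases hs p with h | h <;> cases tau jj p <;> simp [h, sgb]
  set T : Fin (N * M) → Bool := fun q => tau jj (finProdFinEquiv.symm q).1 with hT
  let F : Fin n → (Fin (N * M) → Bool) → ℤ := FF typ ep
  let Star : (Fin (N * M) → Bool) → Prop := fun y =>
    ∀ p, ∃ b, y (finProdFinEquiv (p, b)) = tau jj p
  have FT : ∀ i, F i T = 0 := by
    intro i
    simp only [F]
    rw [FF_eq]
    simp only [hT, Equiv.symm_apply_apply]
    have : ∀ p, ep p * sgb (tau jj p) = s p := by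
      intro p; simp only [hepdef]; cases tau jj p <;> simp [sgb]
    simp only [this, Finset.sum_const]
    rw [← Finset.smul_sum, hbal]
    simp
  have Fstar : ∀ y, Alt n y → Star y → ∀ i, F i y = - 2 *
      ((Finset.univ.filter fun q => y q ≠ T q).filter
        fun q => typ (finProdFinEquiv.symm q).1 = i).card := by
    intro y hy hst i
    rw [← sub_zero (F i y), ← FT i]
    simp only [F]
    unfold FF
    rw [← Finset.sum_sub_distrib, Finset.filter_filter, Finset.card_filter]
    push_cast
    rw [Finset.mul_sum]
    apply Finset.sum_congr rfl
    intro q _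
    by_cases hq : y q = T q
    · simp [hq]
    · by_cases ht : typ (finProdFinEquiv.symm q).1 = i
      · have h1 : s (finProdFinEquiv.symm q).1 = 1 := by
          apply hend
          apply star hN jj hlast hzero hn hstep y hy hst _ (finProdFinEquiv.symm q).2
          rw [Prod.mk.eta, Equiv.apply_symm_apply]
          exact hq
        simp only [ht, hepdef, h1]
        simp only [hT] at hq ⊢
        revert hq
        cases y q <;> cases tau jj (finProdFinEquiv.symm q).1 <;> simp [sgb]
      · rw [if_neg ht, if_neg ht, if_neg (fun h => ht h.2)]; simp
  have near : ∀ y, hammingDist y T < M → Star y := by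
    intro y hy p
    by_contra hc
    push Not at hc
    apply absurd hy
    rw [not_lt]
    unfold hammingDist
    have := Finset.card_le_card_of_injOn (s := (Finset.univ : Finset (Fin M)))
      (t := Finset.univ.filter fun q => y q ≠ T q) (fun b => finProdFinEquiv (p, b))
      (by
        intro b _
        rw [Finset.mem_coe, Finset.mem_filter]
        refine ⟨Finset.mem_univ _, ?_⟩
        simp only [hT, Equiv.symm_apply_apply]
        exact hc b)
      (by intro b _ b' _ h; simpa using h)
    simpa using this
  have q0lt : 0 < N * M := Nat.mul_pos hN hMpos
  let q0 : Fin (N * M) := ⟨0, q0lt⟩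
  have hTq0 : T q0 = true := by
    have : q0 = finProdFinEquiv ((⟨0, hN⟩, ⟨0, hMpos⟩) : Fin N × Fin M) := by
      apply Fin.ext; simp [q0]
    simp only [hT]
    rw [this, Equiv.symm_apply_apply]
    simp [tau, hzero]
  have : Nonempty (Fin n) := ⟨⟨0, hn⟩⟩
  have hmax : ∀ g : Fin n → ℤ, ∃ i, ∀ j, g j ≤ g i := fun g => Finite.exists_max g
  choose I0 hI0 using hmax
  let lam : (Fin (N * M) → Bool) → Fin n × Bool := fun y =>
    (I0 (fun j => |F j y|),
      if F (I0 (fun j => |F j y|)) y = 0 then !(y q0) else decide (0 < F (I0 (fun j => |F j y|)) y))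
  have Fneg : ∀ i y, F i (fun q => !y q) = - F i y := fun i y => FF_neg typ ep i y
  have hodd : ∀ y, lam (fun q => !y q) = ((lam y).1, !(lam y).2) := by
    intro y
    simp only [lam, Fneg, abs_neg, Prod.mk.injEq, true_and, neg_eq_zero]
    split_ifs with h
    · rfl
    · rw [← decide_not, decide_eq_decide]
      omega
  have lamStar : ∀ y, Alt n y → Star y → (lam y).2 = false := by
    intro y hy hst
    simp only [lam]
    have h1 := Fstar y hy hst
    split_ifs with h
    · have hall : ∀ j, F j y = 0 := by
        intro j
        have := hI0 (fun j => |F j y|) j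
        rw [h] at this
        simpa using this
      have : y q0 = T q0 := by
        by_contra hc
        have h2 := h1 (typ (finProdFinEquiv.symm q0).1)
        rw [hall] at h2
        have h3 : ((Finset.univ.filter fun q => y q ≠ T q).filter
          fun q => typ (finProdFinEquiv.symm q).1 = typ (finProdFinEquiv.symm q0).1).card = 0 := by
          omega
        rw [Finset.card_eq_zero] at h3
        have : q0 ∈ (∅ : Finset (Fin (N * M))) := by
          rw [← h3]; simp [hc]
        simp at this
      rw [this, hTq0]; rfl
    · rw [decide_eq_false_iff_not, h1]
      omega
  have lampos : ∀ y, (lam y).2 = true → 0 ≤ F (lam y).1 y := by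
    intro y h
    simp only [lam] at h ⊢
    split_ifs at h with h'
    · rw [h']
    · exact (of_decide_eq_true h).le
  have lamneg : ∀ y, (lam y).2 = false → F (lam y).1 y ≤ 0 := by
    intro y h
    simp only [lam] at h ⊢
    split_ifs at h with h'
    · rw [h']
    · exact not_lt.mp (of_decide_eq_false h)
  have trans : ∀ y y', Alt n y → Alt n y' → hammingDist y y' ≤ n → (∀ i, |F i y| ≤ 2 * n) →
      Star y → Star y' := by
    intro y y' hy hy' hyy hb hst
    apply near
    have h1 := Fstar y hy hst
    have h2 : hammingDist y T ≤ n * n := by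
      unfold hammingDist
      rw [Finset.card_eq_sum_card_fiberwise (t := Finset.univ)
        (f := fun q => typ (finProdFinEquiv.symm q).1) (by intro _ _; simp)]
      have := Finset.sum_le_card_nsmul (Finset.univ : Finset (Fin n))
        (fun i => ((Finset.univ.filter fun q => y q ≠ T q).filter
        fun q => typ (finProdFinEquiv.symm q).1 = i).card) n (by
          intro i _
          have h3 := hb i
          rw [h1, abs_le] at h3
          omega)
      simpa using this
    have h3 := hammingDist_triangle y' y T
    rw [hammingDist_comm y' y] at h3
    omega
  obtain ⟨y, y', hy, hy', hyy, hl, hl'⟩ : ∃ y y', Alt n y ∧ Alt n y' ∧ hammingDist y y' ≤ n ∧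
      (lam y).2 = true ∧ lam y' = ((lam y).1, false) := by
    obtain ⟨y, y', h1, h2, h3, h4⟩ := tucker lam hodd
    cases h : (lam y).2
    · refine ⟨y', y, h2, h1, by rwa [hammingDist_comm], by rw [h4, h]; rfl, ?_⟩
      rw [h4]
      exact Prod.ext rfl h
    · exact ⟨y, y', h1, h2, h3, h, by rw [h4, h]; rfl⟩
  have hl'2 : (lam y').2 = false := by rw [hl']
  have hl'1 : (lam y').1 = (lam y).1 := by rw [hl']
  have b1 := lampos y hl
  have b2 := lamneg y' hl'2
  rw [hl'1] at b2
  have b3 := FF_lip typ ep hep (lam y).1 y y'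
  have hbound : ∀ i, |F i y| ≤ 2 * n := by
    intro i
    have h1 : |F i y| ≤ |F (lam y).1 y| := hI0 (fun j => |F j y|) i
    rw [abs_of_nonneg b1] at h1
    have h2 := (abs_le.mp b3).2
    have h3 : FF typ ep (lam y).1 y = F (lam y).1 y := rfl
    have h4 : FF typ ep (lam y).1 y' = F (lam y).1 y' := rfl
    rw [h3, h4] at h2
    have : (hammingDist y y' : ℤ) ≤ n := by exact_mod_cast hyy
    omega
  have h2M : 2 * n < M := by nlinarith
  obtain ⟨z, hz1, hz2⟩ := round_block hMpos typ s ep hs hep hbal y (fun i =>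
    lt_of_le_of_lt (hbound i) (by exact_mod_cast h2M))
  refine ⟨z, ?_, hz2, ?_, ?_⟩
  · choose a ha using hz1
    obtain ⟨c, b, hc, hcn, hcy⟩ := hy
    refine ⟨fun p => c (finProdFinEquiv (p, a p)), b, ?_, fun p => hcn _, fun p => ?_⟩
    · intro p p' h
      rcases h.eq_or_lt with rfl | h
      · exact le_rfl
      · exact hc (fp_le _ _ h)
    · rw [← ha p]; exact hcy _
  · by_contra hc
    push Not at hc
    have hst : Star y := by
      intro p; rw [← hc p]; exact hz1 p
    have := lamStar y hy hst
    rw [hl] at this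
    exact absurd this (by decide)
  · by_contra hc
    push Not at hc
    have hst : Star (fun q => !y q) := by
      intro p
      obtain ⟨b, hb⟩ := hz1 p
      refine ⟨b, ?_⟩
      show (!y (finProdFinEquiv (p, b))) = tau jj p
      rw [hb]
      have := hc p
      revert this
      cases z p <;> cases tau jj p <;> simp
    have hst' : Star (fun q => !y' q) := by
      apply trans _ _ hy.neg hy'.neg _ _ hst
      · refine le_trans (le_of_eq ?_) hyy
        simp [hammingDist]
      · intro i
        rw [Fneg, abs_neg]; exact hbound i
    have := lamStar _ hy'.neg hst'
    rw [hodd, hl'] at this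
    simp at this

theorem split_aux {α : Type*} (κ : α → ℕ) (m : ℕ) : ∀ (a : ℕ) (l : List α),
    l.Pairwise (fun x y => κ x ≤ κ y) → (∀ x ∈ l, a ≤ κ x ∧ κ x < a + m) →
    ((List.range' a m).map (fun t => l.filter (fun x => κ x = t))).flatten = l := by
  induction m with
  | zero =>
    intro a l _ h
    cases l with
    | nil => simp
    | cons x l => have := h x (by simp); omega
  | succ m ih =>
    intro a l hl h
    have h1 : l.filter (fun x => κ x = a) ++ l.filter (fun x => ¬ κ x = a) = l := by
      clear ih
      induction l with
      | nil => simp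
      | cons x l ihl =>
        rw [List.pairwise_cons] at hl
        have ih2 := ihl hl.2 (fun y hy => h y (by simp [hy]))
        by_cases hx : κ x = a
        · simpa [hx] using ih2
        · have hne : ∀ y ∈ l, ¬ κ y = a := by
            intro y hy
            have := hl.1 y hy
            have := h x (by simp)
            omega
          have e1 : l.filter (fun x => κ x = a) = [] := by
            rw [List.filter_eq_nil_iff]; intro y hy; simpa using hne y hy
          rw [e1] at ih2
          simp only [List.nil_append] at ih2
          rw [List.filter_cons_of_neg (by simpa using hx), e1,
            List.filter_cons_of_pos (by simpa using hx), ih2]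
          simp
    rw [List.range'_succ, List.map_cons, List.flatten_cons]
    have h2 := ih (a + 1) (l.filter (fun x => ¬ κ x = a)) (hl.filter _) (by
      intro x hx
      rw [List.mem_filter] at hx
      have := h x hx.1
      have h3 : ¬ κ x = a := by simpa using hx.2
      omega)
    have h3 : (List.range' (a + 1) m).map (fun t => l.filter (fun x => κ x = t)) =
        (List.range' (a + 1) m).map
          (fun t => (l.filter (fun x => ¬ κ x = a)).filter (fun x => κ x = t)) := by
      apply List.map_congr_left
      intro t ht
      rw [List.mem_range'_1] at ht
      rw [List.filter_filter]
      apply List.filter_congr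
      intro x _
      by_cases hx : κ x = t
      · simp [hx]; omega
      · simp [hx]
    rw [h3, h2, h1]

theorem countP_fr {N : ℕ} (P : Fin N → Prop) [DecidablePred P] :
    (List.finRange N).countP (fun p => decide (P p)) = (Finset.univ.filter P).card := by
  rw [Finset.card_def, Finset.filter_val, ← Multiset.countP_eq_card_filter]
  rfl

theorem final {n N : ℕ} (s : Fin n → List (Fin n × Bool)) (jj : Fin N → ℕ) (c : Fin N → ℕ)
    (letter : Fin N → Fin n × Bool)
    (hj : Monotone jj) (hjn : ∀ p, jj p < n) (hc : Monotone c) (hcn : ∀ p, c p ≤ n)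
    (hsj : ∀ j : Fin n, ((List.finRange N).filter (fun p => jj p = j.val)).map letter = s j)
    (hex : ∀ e, e < 2 → ∃ p, (jj p + c p) % 2 = e)
    (hO : ∀ e, e < 2 → ∀ i, (Finset.univ.filter
        (fun p => (jj p + c p) % 2 = e ∧ letter p = (i, true))).card =
      (Finset.univ.filter (fun p => (jj p + c p) % 2 = e ∧ letter p = (i, false))).card) :
    ∃ (u : ℕ → List (Fin n × Bool)) (k : ℕ → ℕ),
      k 0 = 0 ∧ k n = 2 * n ∧ (∀ j, j < n → k j ≤ k (j + 1)) ∧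
      (∀ j : Fin n,
        s j = ((List.range' (k j) (k ((j : ℕ) + 1) - k j)).map u).flatten) ∧
      (((List.range n).map (fun t => u (2 * t))).flatten ≠ [] ∧
        InO n ((List.range n).map (fun t => u (2 * t))).flatten) ∧
      (((List.range n).map (fun t => u (2 * t + 1))).flatten ≠ [] ∧
        InO n ((List.range n).map (fun t => u (2 * t + 1))).flatten) := by
  set κ : Fin N → ℕ := fun p => jj p + c p with hκ
  have hκm : Monotone κ := fun p q h => Nat.add_le_add (hj h) (hc h)
  have hκn : ∀ p, κ p < 2 * n := fun p => by
    have := hjn p; have := hcn p; simp only [hκ]; omega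
  set u : ℕ → List (Fin n × Bool) := fun t =>
    ((List.finRange N).filter (fun p => κ p = t)).map letter with hu
  set m : ℕ → ℕ := fun j => (Finset.univ.filter (fun p => jj p < j)).sup c with hm
  set k : ℕ → ℕ := fun j => if n ≤ j then 2 * n else j + m j with hk
  have hmn : ∀ j, m j ≤ n := fun j => Finset.sup_le fun p _ => hcn p
  have hmm : ∀ j, m j ≤ m (j + 1) := by
    intro j
    apply Finset.sup_mono
    intro p
    simp only [Finset.mem_filter, Finset.mem_univ, true_and]
    omega
  have hkm : ∀ j, k j ≤ k (j + 1) := by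
    intro j
    have := hmm j
    have := hmn j
    simp only [hk]
    split_ifs <;> omega
  have hkmono : Monotone k := monotone_nat_of_le_succ hkm
  have lower : ∀ p, k (jj p) ≤ κ p := by
    intro p
    have := hjn p
    simp only [hk, hκ]
    rw [if_neg (by omega)]
    apply Nat.add_le_add_left
    apply Finset.sup_le
    intro q hq
    simp only [Finset.mem_filter, Finset.mem_univ, true_and] at hq
    apply hc
    by_contra hcon
    have := hj (not_le.mp hcon).le
    omega
  have upper : ∀ p, κ p < k (jj p + 1) := by
    intro p
    have := hκn p
    simp only [hk]
    split_ifs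
    · exact this
    · have : c p ≤ m (jj p + 1) := Finset.le_sup (f := c) (by simp)
      simp only [hκ]; omega
  have uniq : ∀ p j, k j ≤ κ p → κ p < k (j + 1) → jj p = j := by
    intro p j h1 h2
    have l := lower p
    have u' := upper p
    by_contra hne
    rcases Nat.lt_or_gt_of_ne hne with h | h
    · have := hkmono (show jj p + 1 ≤ j by omega); omega
    · have := hkmono (show j + 1 ≤ jj p by omega); omega
  have hcount : ∀ e, e < 2 → ∀ a, (((List.range n).map (fun t => u (2 * t + e))).flatten).count a
      = (Finset.univ.filter (fun p => κ p % 2 = e ∧ letter p = a)).card := by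
    intro e he a
    rw [List.count_flatten, List.map_map]
    have h1 : ∀ t, (u (2 * t + e)).count a = (Finset.univ.filter
        (fun p => κ p = 2 * t + e ∧ letter p = a)).card := by
      intro t
      rw [← countP_fr]
      simp only [hu]
      rw [List.count, List.countP_map, List.countP_filter]
      apply List.countP_congr
      intro p _
      simp [and_comm]
    have h2 : (List.count a ∘ fun t => u (2 * t + e)) = fun t => (Finset.univ.filter
        (fun p => κ p = 2 * t + e ∧ letter p = a)).card := by
      funext t; exact h1 t
    rw [h2, ← List.sum_toFinset _ List.nodup_range, List.toFinset_range,
      Finset.card_eq_sum_card_fiberwise (t := Finset.range n) (f := fun p => κ p / 2)]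
    · apply Finset.sum_congr rfl
      intro t _
      rw [Finset.filter_filter]
      congr 1
      ext p
      simp only [Finset.mem_filter, Finset.mem_univ, true_and]
      constructor
      · rintro ⟨h, h'⟩; exact ⟨⟨by omega, h'⟩, by omega⟩
      · rintro ⟨⟨h, h'⟩, h''⟩; exact ⟨by omega, h'⟩
    · intro p _
      have := hκn p
      simp only [Finset.coe_range, Set.mem_Iio]
      omega
  have concl : ∀ e, e < 2 → ((List.range n).map (fun t => u (2 * t + e))).flatten ≠ [] ∧
        InO n ((List.range n).map (fun t => u (2 * t + e))).flatten := by
    intro e he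
    constructor
    · intro hnil
      obtain ⟨p, hp⟩ := hex e he
      have h1 := hcount e he (letter p)
      rw [hnil, List.count_nil] at h1
      have h2 := Finset.card_eq_zero.mp h1.symm
      have : p ∈ (∅ : Finset (Fin N)) := by
        rw [← h2]; simp [hκ, hp]
      simp at this
    · intro i
      rw [hcount e he, hcount e he]
      exact hO e he i
  refine ⟨u, k, ?_, ?_, fun j _ => hkm j, ?_, concl 0 (by omega), concl 1 (by omega)⟩
  · simp only [hk, hm]
    split_ifs <;> simp <;> omega
  · simp [hk]
  · intro j
    have h1 := split_aux κ (k (j.val + 1) - k j.val) (k j.val)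
      ((List.finRange N).filter (fun p => jj p = j.val)) (by
        apply List.Pairwise.filter
        exact (List.pairwise_le_finRange N).imp (fun h => hκm h)) (by
        intro p hp
        simp only [List.mem_filter, decide_eq_true_eq] at hp
        have l := lower p
        have u' := upper p
        rw [hp.2] at l u'
        omega)
    have h2 := congrArg (List.map letter) h1
    rw [hsj, List.map_flatten, List.map_map] at h2
    rw [← h2]
    congr 1
    apply List.map_congr_left
    intro t ht
    rw [List.mem_range'_1] at ht
    simp only [Function.comp, hu]
    congr 1
    rw [List.filter_filter]
    apply List.filter_congr
    intro p _
    by_cases hp : κ p = t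
    · have := uniq p j.val (by omega) (by have := hkm j.val; omega)
      simp [hp, this]
    · simp [hp]

theorem sig_val {n : ℕ} (len : Fin n → ℕ) :
    ∃ PS : ℕ → ℕ, PS 0 = 0 ∧ (∀ j : Fin n, PS (j.val + 1) = PS j.val + len j) ∧
      PS n = ∑ j, len j ∧
      ∀ (j : Fin n) (x : Fin (len j)),
        (finSigmaFinEquiv (⟨j, x⟩ : (j : Fin n) × Fin (len j))).val = PS j.val + x.val := by
  refine ⟨fun j => ∑ i ∈ Finset.range j, if h : i < n then len ⟨i, h⟩ else 0, by simp, ?_, ?_, ?_⟩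
  · intro j
    simp [Finset.sum_range_succ]
  · simp only [Finset.sum_range]
    apply Finset.sum_congr rfl
    intro i _
    simp
  · intro j x
    rw [finSigmaFinEquiv_apply]
    simp only [Finset.sum_range]
    congr 1
    apply Finset.sum_congr rfl
    intro i _
    have : i.val < n := by omega
    simp [this, Fin.castLE]

theorem sig_step {n : ℕ} (len : Fin n → ℕ) (hlen : ∀ j, 1 ≤ len j)
    (p q : (j : Fin n) × Fin (len j))
    (h : (finSigmaFinEquiv q).val = (finSigmaFinEquiv p).val + 1) :
    (q.1.val = p.1.val) ∨ (q.1.val = p.1.val + 1) := by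
  obtain ⟨PS, h0, hs, hN, hv⟩ := sig_val len
  obtain ⟨j, x⟩ := p
  obtain ⟨j', x'⟩ := q
  rw [hv, hv] at h
  by_cases hx : x.val + 1 < len j
  · left
    have : finSigmaFinEquiv (⟨j', x'⟩ : (j : Fin n) × Fin (len j)) =
        finSigmaFinEquiv (⟨j, ⟨x.val + 1, hx⟩⟩ : (j : Fin n) × Fin (len j)) := by
      apply Fin.ext
      rw [hv, hv]; simp; omega
    have := finSigmaFinEquiv.injective this
    have := congrArg (fun k => k.1.val) this
    simpa using this
  · right
    have hx2 := x.isLt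
    by_cases hj : j.val + 1 < n
    · have : finSigmaFinEquiv (⟨j', x'⟩ : (j : Fin n) × Fin (len j)) =
        finSigmaFinEquiv (⟨⟨j.val + 1, hj⟩, ⟨0, hlen _⟩⟩ : (j : Fin n) × Fin (len j)) := by
        apply Fin.ext
        rw [hv, hv]
        have := hs j
        simp; omega
      have := finSigmaFinEquiv.injective this
      have := congrArg (fun k => k.1.val) this
      simpa using this
    · exfalso
      have h1 := (finSigmaFinEquiv (⟨j', x'⟩ : (j : Fin n) × Fin (len j))).isLt
      have h2 := hs j
      rw [hv] at h1
      have h3 : j.val + 1 = n := by omega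
      rw [h3] at h2
      omega

theorem mono_of_step {N : ℕ} (jj : Fin N → ℕ)
    (hstep : ∀ p q : Fin N, q.val = p.val + 1 → jj q = jj p ∨ jj q = jj p + 1) :
    Monotone jj := by
  have key : ∀ d : ℕ, ∀ p q : Fin N, q.val = p.val + d → jj p ≤ jj q := by
    intro d
    induction d with
    | zero =>
      intro p q h
      have : p = q := Fin.ext (by omega)
      rw [this]
    | succ d ih =>
      intro p q h
      have h1 := ih p ⟨p.val + d, by omega⟩ rfl
      have h2 := hstep ⟨p.val + d, by omega⟩ q (by simp; omega)
      omega
  intro p q h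
  exact key (q.val - p.val) p q (by have : p.val ≤ q.val := h; omega)

theorem sig_filter {n : ℕ} (len : Fin n → ℕ) (j : Fin n) :
    (List.finRange (∑ j, len j)).filter
        (fun p => (finSigmaFinEquiv.symm p : (j : Fin n) × Fin (len j)).1.val = j.val) =
      (List.finRange (len j)).map
        (fun x => finSigmaFinEquiv (⟨j, x⟩ : (j : Fin n) × Fin (len j))) := by
  obtain ⟨PS, h0, hs, hN, hv⟩ := sig_val len
  have s1 : ((List.finRange (∑ j, len j)).filter
        (fun p => (finSigmaFinEquiv.symm p : (j : Fin n) × Fin (len j)).1.val = j.val)).Pairwise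
        (· < ·) := (List.pairwise_lt_finRange _).filter _
  have s2 : ((List.finRange (len j)).map
        (fun x => finSigmaFinEquiv (⟨j, x⟩ : (j : Fin n) × Fin (len j)))).Pairwise (· < ·) := by
    rw [List.pairwise_map]
    apply (List.pairwise_lt_finRange _).imp
    intro a b hab
    rw [Fin.lt_def, hv, hv]
    have : a.val < b.val := hab
    omega
  apply List.Perm.eq_of_pairwise (le := (· < ·)) _ s1 s2
  · rw [List.perm_ext_iff_of_nodup]
    · intro p
      obtain ⟨⟨j', x⟩, rfl⟩ := finSigmaFinEquiv.surjective p
      simp only [List.mem_filter, List.mem_finRange, true_and, Equiv.symm_apply_apply,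
        decide_eq_true_eq, List.mem_map, EmbeddingLike.apply_eq_iff_eq]
      constructor
      · intro h
        obtain rfl : j' = j := Fin.ext h
        exact ⟨x, rfl⟩
      · rintro ⟨y, hy⟩
        exact (congrArg (fun k => k.1.val) hy).symm
    · exact s1.imp (fun h => ne_of_lt h)
    · exact s2.imp (fun h => ne_of_lt h)
  · intro a b _ _ h1 h2
    exact absurd h1 (not_lt.mpr h2.le)

theorem parity_aux {n N : ℕ} (letter : Fin N → Fin n × Bool) (η : Fin n → ℤ)
    (hη : ∀ i, η i = 1 ∨ η i = -1) (jj c : Fin N → ℕ) (b : Bool) (z : Fin N → Bool)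
    (hz : ∀ p, z p = (b ^^ decide (c p % 2 = 1)))
    (h0 : ∀ i, (Finset.univ.filter (fun p => letter p = (i, true))).card =
      (Finset.univ.filter (fun p => letter p = (i, false))).card)
    (h1 : ∀ i, ∑ p, (if (letter p).1 = i then
      ((η (letter p).1 * sgb (letter p).2) * sgb (tau jj p)) * sgb (z p) else 0) = 0) :
    ∀ e, e < 2 → ∀ i, (Finset.univ.filter
        (fun p => (jj p + c p) % 2 = e ∧ letter p = (i, true))).card =
      (Finset.univ.filter (fun p => (jj p + c p) % 2 = e ∧ letter p = (i, false))).card := by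
  intro e he i
  have hsplit : ∀ v, (Finset.univ.filter (fun p => letter p = (i, v))).card =
      (Finset.univ.filter (fun p => (jj p + c p) % 2 = 0 ∧ letter p = (i, v))).card +
      (Finset.univ.filter (fun p => (jj p + c p) % 2 = 1 ∧ letter p = (i, v))).card := by
    intro v
    rw [Finset.card_filter, Finset.card_filter, Finset.card_filter, ← Finset.sum_add_distrib]
    apply Finset.sum_congr rfl
    intro p _
    rcases Nat.mod_two_eq_zero_or_one (jj p + c p) with h | h <;> simp [h]
  have hsum : (η i * sgb b) *
      (((Finset.univ.filter (fun p => (jj p + c p) % 2 = 0 ∧ letter p = (i, true))).card : ℤ) -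
      ((Finset.univ.filter (fun p => (jj p + c p) % 2 = 1 ∧ letter p = (i, true))).card : ℤ) -
      ((Finset.univ.filter (fun p => (jj p + c p) % 2 = 0 ∧ letter p = (i, false))).card : ℤ) +
      ((Finset.univ.filter (fun p => (jj p + c p) % 2 = 1 ∧ letter p = (i, false))).card : ℤ))
      = 0 := by
    rw [← h1 i]
    simp only [Finset.card_filter, Nat.cast_sum]
    rw [← Finset.sum_sub_distrib, ← Finset.sum_sub_distrib, ← Finset.sum_add_distrib,
      Finset.mul_sum]
    apply Finset.sum_congr rfl
    intro p _
    rw [hz p]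
    rcases hl : letter p with ⟨i', v⟩
    by_cases hi : i' = i
    · subst hi
      rcases Nat.mod_two_eq_zero_or_one (jj p) with h | h <;>
      rcases Nat.mod_two_eq_zero_or_one (c p) with h' | h' <;>
      cases v <;> cases b <;> simp [tau, sgb, h, h', Nat.add_mod]
    · simp [hi]
  have hne : η i * sgb b ≠ 0 := by
    rcases hη i with h | h <;> cases b <;> simp [h, sgb]
  have h2 := (mul_eq_zero.mp hsum).resolve_left hne
  have h3 := h0 i
  rw [hsplit, hsplit] at h3
  interval_cases e <;> omega

theorem bal_aux {n N : ℕ} (letter : Fin N → Fin n × Bool) (η : Fin n → ℤ)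
    (h0 : ∀ i, (Finset.univ.filter (fun p => letter p = (i, true))).card =
      (Finset.univ.filter (fun p => letter p = (i, false))).card) (i : Fin n) :
    ∑ p, (if (letter p).1 = i then η (letter p).1 * sgb (letter p).2 else 0) = 0 := by
  have h : ∑ p, (if (letter p).1 = i then η (letter p).1 * sgb (letter p).2 else 0) =
      η i * (((Finset.univ.filter (fun p => letter p = (i, true))).card : ℤ) -
      ((Finset.univ.filter (fun p => letter p = (i, false))).card : ℤ)) := by
    simp only [Finset.card_filter, Nat.cast_sum]
    rw [← Finset.sum_sub_distrib, Finset.mul_sum]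
    apply Finset.sum_congr rfl
    intro p _
    rcases hl : letter p with ⟨i', v⟩
    by_cases hi : i' = i
    · subst hi
      cases v <;> simp [sgb]
    · simp [hi]
  rw [h, h0 i]; simp

/-- decomposition lemma: let `(s_1, …, s_n)` be a tuple of words
over `Σ_n`, each of length at least 2, with `s_1 ⋯ s_n ∈ O_n`, which is
irreducible: no two of the `2n` endpoints (an endpoint of `s_j` is indexed by a
pair `(j, e)`, `e = true` for the first letter, `e = false` for the last one)
carry compatible letters `α, ᾱ`. Then there are words `u_1, …, u_{2n}` and cut
indices `0 = k_0 ≤ k_1 ≤ ⋯ ≤ k_n = 2n` with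
`s_j = u_{k_{j-1}+1} ⋯ u_{k_j}` and both alternating concatenations
`u_1 u_3 ⋯ u_{2n-1}` and `u_2 u_4 ⋯ u_{2n}` nonempty elements of `O_n`. -/
theorem stmt17 (n : ℕ) (hn : 1 ≤ n) (s : Fin n → List (Fin n × Bool))
    (hlen : ∀ j, 2 ≤ (s j).length)
    (hbal : InO n (List.ofFn s).flatten)
    (hirr : ∀ p q : Fin n × Bool, p ≠ q →
      (s q.1).getD (if q.2 then 0 else (s q.1).length - 1) (⟨0, hn⟩, true) ≠
        (((s p.1).getD (if p.2 then 0 else (s p.1).length - 1) (⟨0, hn⟩, true)).1,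
          !((s p.1).getD (if p.2 then 0 else (s p.1).length - 1) (⟨0, hn⟩, true)).2)) :
    ∃ (u : ℕ → List (Fin n × Bool)) (k : ℕ → ℕ),
      k 0 = 0 ∧ k n = 2 * n ∧ (∀ j, j < n → k j ≤ k (j + 1)) ∧
      (∀ j : Fin n,
        s j = ((List.range' (k j) (k ((j : ℕ) + 1) - k j)).map u).flatten) ∧
      (((List.range n).map (fun t => u (2 * t))).flatten ≠ [] ∧
        InO n ((List.range n).map (fun t => u (2 * t))).flatten) ∧
      (((List.range n).map (fun t => u (2 * t + 1))).flatten ≠ [] ∧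
        InO n ((List.range n).map (fun t => u (2 * t + 1))).flatten) := by
  classical
  set len : Fin n → ℕ := fun j => (s j).length with hlendef
  set N : ℕ := ∑ j, len j with hNdef
  obtain ⟨PS, hP0, hPs, hPN, hPv⟩ := sig_val len
  let E : ((j : Fin n) × Fin (len j)) ≃ Fin N := finSigmaFinEquiv
  have hEv : ∀ (j : Fin n) (x : Fin (len j)), (E ⟨j, x⟩).val = PS j.val + x.val := hPv
  let jj : Fin N → ℕ := fun p => (E.symm p).1.val
  let letter : Fin N → Fin n × Bool := fun p => (s (E.symm p).1).get (E.symm p).2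
  have hjE : ∀ k, jj (E k) = k.1.val := fun k => by simp [jj]
  have hlE : ∀ k, letter (E k) = (s k.1).get k.2 := fun k => by
    simp only [letter]; rw [Equiv.symm_apply_apply]
  have hlen1 : ∀ j, 1 ≤ len j := fun j => by have := hlen j; simp only [hlendef]; omega
  have hNpos : 0 < N := lt_of_le_of_lt (Nat.zero_le _)
    (E ⟨⟨0, hn⟩, ⟨0, hlen1 _⟩⟩).isLt
  have hstep : ∀ p q : Fin N, q.val = p.val + 1 → jj q = jj p ∨ jj q = jj p + 1 := by
    intro p q h
    obtain ⟨p', rfl⟩ := E.surjective p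
    obtain ⟨q', rfl⟩ := E.surjective q
    rw [hjE, hjE]
    exact sig_step len hlen1 p' q' h
  have hmono := mono_of_step jj hstep
  have hjn : ∀ p, jj p < n := fun p => (E.symm p).1.isLt
  have hzero : jj ⟨0, hNpos⟩ = 0 := by
    have : (⟨0, hNpos⟩ : Fin N) = E ⟨⟨0, hn⟩, ⟨0, hlen1 _⟩⟩ := by
      apply Fin.ext; rw [hEv]; simp [hP0]
    rw [this, hjE]
  have hlast : jj ⟨N - 1, by omega⟩ = n - 1 := by
    have : (⟨N - 1, by omega⟩ : Fin N) =
        E ⟨⟨n - 1, by omega⟩, ⟨len ⟨n - 1, by omega⟩ - 1, by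
          have := hlen1 ⟨n - 1, by omega⟩; omega⟩⟩ := by
      apply Fin.ext; rw [hEv]
      have h1 := hPs ⟨n - 1, by omega⟩
      have h2 := hlen1 ⟨n - 1, by omega⟩
      simp only at h1 ⊢
      rw [show n - 1 + 1 = n by omega] at h1
      omega
    rw [this, hjE]
  have hsj : ∀ j : Fin n,
      ((List.finRange N).filter (fun p => jj p = j.val)).map letter = s j := by
    intro j
    have h1 := sig_filter len j
    have h2 : (List.finRange N).filter (fun p => jj p = j.val) =
      (List.finRange (len j)).map (fun x => E ⟨j, x⟩) := h1
    rw [h2, List.map_map]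
    have h3 : (letter ∘ fun x => E ⟨j, x⟩) = (s j).get := by
      funext x
      exact hlE _
    rw [h3]
    exact List.map_get_finRange (s j)
  have hcnt : ∀ a, (List.ofFn s).flatten.count a =
      (Finset.univ.filter (fun p => letter p = a)).card := by
    intro a
    rw [List.count_flatten, List.map_ofFn, List.sum_ofFn,
      Finset.card_eq_sum_card_fiberwise (t := Finset.univ) (f := fun p => (E.symm p).1)
        (by intro p _; simp)]
    apply Finset.sum_congr rfl
    intro j _
    simp only [Function.comp]
    rw [← hsj j, List.count, List.countP_map, List.countP_filter, Finset.filter_filter,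
      ← countP_fr]
    apply List.countP_congr
    intro p _
    simp [jj, Fin.ext_iff]
  have h0 : ∀ i, (Finset.univ.filter (fun p => letter p = (i, true))).card =
      (Finset.univ.filter (fun p => letter p = (i, false))).card := by
    intro i
    rw [← hcnt, ← hcnt]
    exact hbal i
  let ends : Fin n × Bool → Fin n × Bool := fun p =>
    (s p.1).getD (if p.2 then 0 else (s p.1).length - 1) (⟨0, hn⟩, true)
  have hirr' : ∀ p q, p ≠ q → ends q ≠ ((ends p).1, !(ends p).2) := hirr
  let η : Fin n → ℤ := fun i => if ∃ q, ends q = (i, false) then -1 else 1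
  have hη : ∀ i, η i = 1 ∨ η i = -1 := by
    intro i; simp only [η]; split_ifs <;> simp
  have hendη : ∀ q, η (ends q).1 * sgb (ends q).2 = 1 := by
    intro q
    rcases hq : ends q with ⟨i, v⟩
    cases v
    · have : ∃ q, ends q = (i, false) := ⟨q, hq⟩
      simp only [η]
      first | rw [if_pos this] | rw [if_neg this]
      simp [sgb]
    · have : ¬ ∃ q, ends q = (i, false) := by
        rintro ⟨q', hq'⟩
        have hne : q' ≠ q := by
          rintro rfl
          rw [hq] at hq'
          simp at hq'
        apply hirr' q' q hne
        rw [hq, hq']; simp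
      simp only [η]
      first | rw [if_pos this] | rw [if_neg this]
      simp [sgb]
  obtain ⟨z, ⟨c, b, hc, hcn, hcz⟩, hsum, ⟨p1, hp1⟩, ⟨p2, hp2⟩⟩ := core hn hNpos jj hlast hzero hstep
    (fun p => (letter p).1) (fun p => η (letter p).1 * sgb (letter p).2)
    (by
      intro p
      rcases hη (letter p).1 with h | h <;> cases hv : (letter p).2 <;> simp [h, sgb])
    (bal_aux letter η h0)
    (by
      intro p hp
      obtain ⟨⟨j, x⟩, rfl⟩ := E.surjective p
      have hx := x.isLt
      have key : x.val = 0 ∨ x.val = len j - 1 := by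
        by_contra hcon
        push Not at hcon
        apply hp
        refine ⟨E ⟨j, ⟨x.val - 1, by omega⟩⟩, E ⟨j, ⟨x.val + 1, by omega⟩⟩, ?_, ?_, ?_, ?_⟩
        · rw [hEv, hEv]; simp only; omega
        · rw [hEv, hEv]; simp only; omega
        · rw [hjE, hjE]
        · rw [hjE, hjE]
      have : ∃ q, ends q = letter (E ⟨j, x⟩) := by
        rw [hlE]
        rcases key with h | h
        · refine ⟨(j, true), ?_⟩
          simp only [ends, if_true]
          have hx0 : 0 < (s j).length := hlen1 j
          rw [List.getD_eq_getElem _ _ hx0]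
          have h2 : x = ⟨0, hx0⟩ := Fin.ext h
          rw [h2]
          rfl
        · refine ⟨(j, false), ?_⟩
          have h' : (s j).length - 1 = x.val := h.symm
          simp only [ends, Bool.false_eq_true, if_false]
          rw [h', List.getD_eq_getElem _ _ hx]
          rfl
      obtain ⟨q, hq⟩ := this
      rw [← hq]
      exact hendη q)
  apply final s jj c letter hmono hjn hc hcn hsj
  · intro e he
    have par : ∀ p, ((jj p + c p) % 2 = 0 ↔ (z p = tau jj p ↔ b = true)) := by
      intro p
      rw [hcz p]
      rcases Nat.mod_two_eq_zero_or_one (jj p) with h | h <;>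
      rcases Nat.mod_two_eq_zero_or_one (c p) with h' | h' <;>
      cases b <;> simp [tau, h, h', Nat.add_mod]
    have q1 := par p1
    have q2 := par p2
    have : e = 0 ∨ e = 1 := by omega
    cases b
    · rcases this with rfl | rfl
      · exact ⟨p1, q1.mpr (by simp [hp1])⟩
      · refine ⟨p2, ?_⟩
        have : ¬ (jj p2 + c p2) % 2 = 0 := fun h => by simpa [hp2] using q2.mp h
        omega
    · rcases this with rfl | rfl
      · exact ⟨p2, q2.mpr (by simp [hp2])⟩
      · refine ⟨p1, ?_⟩
        have : ¬ (jj p1 + c p1) % 2 = 0 := fun h => by simpa [hp1] using q1.mp h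
        omega
  · exact parity_aux letter η hη jj c b z hcz h0 hsum
end
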